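/- Let n ≥ 2 and for each natural number L let a(L) denote the (finite) number of fully commutative involutions of Coxeter length L in the affine Coxeter group of type C̃_n. Then the sequence (a(L)) is ultimately periodic with period dividing 2n+2: there exists N such that a(L + 2n + 2) = a(L) for all L ≥ N. -/

import Mathlib

open CoxeterSystem

/-- A single commutation move: transposition of two adjacent letters `a`, `b`
with `M a b = 2`. -/
def CommMove {B : Type*} (M : CoxeterMatrix B) (w w' : List B) : Prop :=
  ∃ (u v : List B) (a b : B), M a b = 2 ∧ w = u ++ a :: b :: v ∧ w' = u ++ b :: a :: v

/-- Commutation equivalence of words: two words are commutation-equivalent if one can be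
obtained from the other by a sequence of transpositions of adjacent commuting letters. -/
def CommEquiv {B : Type*} (M : CoxeterMatrix B) : List B → List B → Prop :=
  Relation.EqvGen (CommMove M)

/-- An element is fully commutative if all its reduced words are commutation-equivalent. -/
def IsFullyCommutative {B W : Type*} [Group W] {M : CoxeterMatrix B}
    (cs : CoxeterSystem M W) (w : W) : Prop :=
  ∀ u v : List B, cs.IsReduced u → cs.wordProd u = w →
    cs.IsReduced v → cs.wordProd v = w → CommEquiv M u v

/-- A fully commutative involution (the identity is allowed). -/
def IsFCInvolution {B W : Type*} [Group W] {M : CoxeterMatrix B}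
    (cs : CoxeterSystem M W) (w : W) : Prop :=
  IsFullyCommutative cs w ∧ w * w = 1

/-- The Coxeter matrix of affine type `C̃_n` (for `n ≥ 2`): generators `s_0, s_1, …, s_n`
(index `k : Fin (n+1)` corresponds to `s_k`) arranged along a path, with
`m(s_0, s_1) = 4`, `m(s_{n-1}, s_n) = 4`, `m(s_i, s_{i+1}) = 3` for `1 ≤ i ≤ n-2`,
and `m(s_i, s_j) = 2` for all non-adjacent pairs `i ≠ j`. -/
def affineC (n : ℕ) : CoxeterMatrix (Fin (n + 1)) where
  M := Matrix.of fun i j : Fin (n + 1) =>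
    if (i : ℕ) = (j : ℕ) then 1
    else if (i : ℕ) + 1 = (j : ℕ) ∨ (j : ℕ) + 1 = (i : ℕ) then
      (if (i : ℕ) = 0 ∨ (j : ℕ) = 0 ∨ (i : ℕ) = n ∨ (j : ℕ) = n then 4 else 3)
    else 2
  isSymm := by
    ext i j
    simp only [Matrix.transpose_apply, Matrix.of_apply]
    split_ifs <;> omega
  diagonal := by intro i; simp [Matrix.of_apply]
  off_diagonal := by
    intro i j hij
    have h : (i : ℕ) ≠ (j : ℕ) := fun h => hij (Fin.ext h)
    simp only [Matrix.of_apply]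
    split_ifs <;> omega

namespace CoxeterSystem

section ExchangeProperty

variable {B W : Type*} [Group W] {M : CoxeterMatrix B} (cs : CoxeterSystem M W)

theorem reverse_alternatingWord_two_mul (i j : B) (p : ℕ) :
    (alternatingWord i j (2 * p)).reverse = alternatingWord j i (2 * p) := by
  induction p generalizing i j with
  | zero => simp [alternatingWord]
  | succ p ih =>
    have h : 2 * (p + 1) = 2 * p + 1 + 1 := by ring
    rw [h, alternatingWord_succ', alternatingWord_succ, alternatingWord_succ j i,
      alternatingWord_succ' i j]
    simp [ih]

theorem leftInvSeq_alternatingWord_two_mul (i j : B) :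
    ∃ L, cs.leftInvSeq (alternatingWord i j (2 * M i j)) = L ++ L := by
  refine ⟨(cs.leftInvSeq (alternatingWord i j (2 * M i j))).take (M i j), ?_⟩
  apply List.ext_getElem
  · simp; omega
  · intro k h₁ h₂
    have hk : k < 2 * M i j := by simpa using h₁
    have key : ∀ k, cs.wordProd (alternatingWord j i (2 * k + 1)) =
        cs.simple i * (cs.simple j * cs.simple i) ^ k := by
      intro k
      rw [prod_alternatingWord_eq_mul_pow, if_neg (by simp)]
      congr 2; omega
    rw [List.getElem_append]
    split_ifs with h
    · simp
    · have h' : M i j ≤ k := by simp at h; omega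
      simp only [List.getElem_take, List.length_take, length_leftInvSeq, length_alternatingWord]
      rw [cs.getElem_leftInvSeq_alternatingWord _ _ _ _ hk,
        cs.getElem_leftInvSeq_alternatingWord _ _ _ _ (by omega), key, key]
      obtain ⟨l, rfl⟩ := Nat.exists_eq_add_of_le h'
      have : min (M i j) (2 * M i j) = M i j := by omega
      rw [this, Nat.add_sub_cancel_left, pow_add, cs.simple_mul_simple_pow', one_mul]

open Classical in
/-- The step of the signed-reflection action attached to a simple reflection. -/
noncomputable def signedStep (i : B) : Function.End (W × ZMod 2) := fun p =>
  (cs.simple i * p.1 * cs.simple i, p.2 + if p.1 = cs.simple i then 1 else 0)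

open Classical in
theorem prod_map_signedStep (ω : List B) (p : W × ZMod 2) :
    (ω.map cs.signedStep).prod p =
      (cs.wordProd ω * p.1 * (cs.wordProd ω)⁻¹, p.2 + ((cs.rightInvSeq ω).count p.1 : ZMod 2)) := by
  induction ω with
  | nil => simp [Function.End.one_def]
  | cons i ω ih =>
    rw [List.map_cons, List.prod_cons]
    change cs.signedStep i ((ω.map cs.signedStep).prod p) = _
    rw [ih]
    simp only [signedStep, wordProd_cons, rightInvSeq, List.count_cons, mul_inv_rev, inv_simple,
      mul_assoc, beq_iff_eq, Prod.mk.injEq, true_and]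
    have : cs.wordProd ω * (p.1 * (cs.wordProd ω)⁻¹) = cs.simple i ↔
        (cs.wordProd ω)⁻¹ * (cs.simple i * cs.wordProd ω) = p.1 := by
      constructor <;> intro h
      · rw [← h]; group
      · rw [← h]; group
    simp only [this]
    split_ifs <;> push_cast <;> ring

theorem isLiftable_signedStep : M.IsLiftable cs.signedStep := by
  classical
  intro i j
  have h : (cs.signedStep i * cs.signedStep j) ^ M i j =
      ((alternatingWord i j (2 * M i j)).map cs.signedStep).prod := by
    generalize M i j = m
    induction m with
    | zero => simp [alternatingWord]
    | succ m ih =>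
      have h : 2 * (m + 1) = 2 * m + 1 + 1 := by ring
      rw [h, alternatingWord_succ, alternatingWord_succ]
      simp [ih, pow_succ]
  rw [h]
  funext p
  rw [prod_map_signedStep]
  obtain ⟨L, hL⟩ := cs.leftInvSeq_alternatingWord_two_mul j i
  have hprod : cs.wordProd (alternatingWord i j (2 * M i j)) = 1 := by
    rw [prod_alternatingWord_eq_mul_pow]; simp
  have hr : cs.rightInvSeq (alternatingWord i j (2 * M i j)) = (L ++ L).reverse := by
    rw [← hL, ← rightInvSeq_reverse, reverse_alternatingWord_two_mul, M.symmetric j i]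
  rw [hprod, hr]
  have h2 : ∀ x : ZMod 2, x + x = 0 := by decide
  simp [h2, Function.End.one_def]

open Classical in
/-- The parity of the number of occurrences of an element in the right inversion sequence of a
word only depends on the product of the word. -/
theorem count_rightInvSeq_cast_eq {ω ω' : List B} (h : cs.wordProd ω = cs.wordProd ω') (t : W) :
    ((cs.rightInvSeq ω).count t : ZMod 2) = (cs.rightInvSeq ω').count t := by
  have key : ∀ ω : List B, (ω.map cs.signedStep).prod =
      cs.lift ⟨cs.signedStep, cs.isLiftable_signedStep⟩ (cs.wordProd ω) := by
    intro ω
    rw [wordProd, map_list_prod, List.map_map]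
    congr 1
    apply List.map_congr_left
    simp
  have h' := (key ω).trans ((congrArg _ h).trans (key ω').symm)
  have := congrFun h' (t, 0)
  rw [prod_map_signedStep, prod_map_signedStep] at this
  simpa using congrArg Prod.snd this

theorem mem_rightInvSeq_of_nodup {ω ω' : List B} (h : cs.wordProd ω = cs.wordProd ω')
    (hω : (cs.rightInvSeq ω).Nodup) {t : W} (ht : t ∈ cs.rightInvSeq ω) :
    t ∈ cs.rightInvSeq ω' := by
  classical
  by_contra hn
  have := cs.count_rightInvSeq_cast_eq h t
  rw [List.count_eq_one_of_mem hω ht, List.count_eq_zero_of_not_mem hn] at this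
  simp at this

theorem isReduced_of_nodup_rightInvSeq {ω : List B} (hω : (cs.rightInvSeq ω).Nodup) :
    cs.IsReduced ω := by
  obtain ⟨ω', hr, h⟩ := cs.exists_isReduced (cs.wordProd ω)
  have hsub : cs.rightInvSeq ω ⊆ cs.rightInvSeq ω' :=
    fun t ht => cs.mem_rightInvSeq_of_nodup h hω ht
  have hlen := (hω.subperm hsub).length_le
  simp only [length_rightInvSeq] at hlen
  have h1 := cs.length_wordProd_le ω
  have h2 : cs.length (cs.wordProd ω') = ω'.length := hr
  rw [← h] at h2
  exact le_antisymm h1 (by omega)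

/-- The exchange property. -/
theorem exists_eraseIdx_of_isRightDescent {ω : List B} {s : B}
    (h : cs.IsRightDescent (cs.wordProd ω) s) :
    ∃ j < ω.length, cs.wordProd ω * cs.simple s = cs.wordProd (ω.eraseIdx j) := by
  obtain ⟨ω', hr, h'⟩ := cs.exists_isReduced (cs.wordProd ω * cs.simple s)
  have heq : cs.wordProd (ω' ++ [s]) = cs.wordProd ω := by
    rw [wordProd_append, ← h', wordProd_singleton, mul_assoc, simple_mul_simple_self, mul_one]
  have hred : cs.IsReduced (ω' ++ [s]) := by
    have h1 := cs.isRightDescent_iff.mp h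
    rw [h', hr.eq] at h1
    rw [IsReduced, heq]
    simp [← h1]
  have hmem : cs.simple s ∈ cs.rightInvSeq (ω' ++ [s]) := by
    rw [← List.concat_eq_append, rightInvSeq_concat]
    simp
  have := cs.mem_rightInvSeq_of_nodup heq hred.nodup_rightInvSeq hmem
  obtain ⟨j, hj, hs⟩ := List.mem_iff_getElem.mp this
  refine ⟨j, by simpa using hj, ?_⟩
  rw [← wordProd_mul_getD_rightInvSeq, List.getD_eq_getElem _ _ hj, hs]

theorem isReduced_take_alternatingWord
    (hord : ∀ s t k, 0 < k → k < M s t → (cs.simple s * cs.simple t) ^ k ≠ 1)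
    (s t : B) {k : ℕ} (hk : k ≤ M s t) :
    cs.IsReduced ((alternatingWord s t (2 * k)).take k) := by
  rw [← isReduced_reverse_iff]
  apply isReduced_of_nodup_rightInvSeq
  rw [rightInvSeq_reverse, List.nodup_reverse, leftInvSeq_take, List.nodup_iff_injective_get]
  rintro ⟨a, ha⟩ ⟨b, hb⟩ hab
  have ha' : a < k := by simp at ha; omega
  have hb' : b < k := by simp at hb; omega
  simp only [List.get_eq_getElem, List.getElem_take] at hab
  rw [cs.getElem_leftInvSeq_alternatingWord _ _ _ _ (by omega),
    cs.getElem_leftInvSeq_alternatingWord _ _ _ _ (by omega),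
    prod_alternatingWord_eq_mul_pow, prod_alternatingWord_eq_mul_pow,
    if_neg (by simp), if_neg (by simp), mul_right_inj] at hab
  have e : ∀ a : ℕ, (2 * a + 1) / 2 = a := by omega
  rw [e, e] at hab
  rw [M.symmetric] at hk
  have main : ∀ a b, a < k → b < k → a < b →
      (cs.simple t * cs.simple s) ^ a = (cs.simple t * cs.simple s) ^ b → False := by
    intro a b ha hb hlt hab
    obtain ⟨d, rfl⟩ := Nat.exists_eq_add_of_lt hlt
    rw [add_assoc, pow_add, left_eq_mul] at hab
    exact hord t s (d + 1) (by omega) (by omega) hab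
  rcases lt_trichotomy a b with h | h | h
  · exact (main a b ha' hb' h hab).elim
  · simp [h]
  · exact (main b a hb' ha' h hab.symm).elim

theorem isReduced_alternatingWord
    (hord : ∀ s t k, 0 < k → k < M s t → (cs.simple s * cs.simple t) ^ k ≠ 1)
    (s t : B) {k : ℕ} (hk : k ≤ M s t) : cs.IsReduced (alternatingWord s t k) := by
  rcases k.eq_zero_or_pos with rfl | hpos
  · simp [alternatingWord, IsReduced]
  · have h1 := cs.isReduced_take_alternatingWord hord s t hk
    have h2 := cs.isReduced_take_alternatingWord hord t s (k := k) (by rwa [M.symmetric t s])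
    rw [listTake_alternatingWord _ _ _ _ (by omega)] at h1 h2
    split_ifs at h1 h2 <;> assumption

end ExchangeProperty

section Matsumoto

variable {B W : Type*} [Group W] {M : CoxeterMatrix B} (cs : CoxeterSystem M W)

/-- A braid move: replacing a factor that is a braid word by the opposite braid word. -/
def BraidMove (M : CoxeterMatrix B) (u v : List B) : Prop :=
  ∃ (x y : List B) (s t : B), u = x ++ braidWord M s t ++ y ∧ v = x ++ braidWord M t s ++ y

theorem BraidMove.append_right {u v : List B} (h : BraidMove M u v) (z : List B) :
    BraidMove M (u ++ z) (v ++ z) := by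
  obtain ⟨x, y, s, t, rfl, rfl⟩ := h
  exact ⟨x, y ++ z, s, t, by simp, by simp⟩

theorem BraidMove.wordProd_eq {u v : List B} (h : BraidMove M u v) :
    cs.wordProd u = cs.wordProd v := by
  obtain ⟨x, y, s, t, rfl, rfl⟩ := h
  simp only [wordProd_append, wordProd_braidWord_eq cs s t]

theorem braidEquiv_append_right {u v : List B} (h : Relation.EqvGen (BraidMove M) u v)
    (z : List B) : Relation.EqvGen (BraidMove M) (u ++ z) (v ++ z) := by
  induction h with
  | rel _ _ h => exact .rel _ _ (h.append_right z)
  | refl _ => exact .refl _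
  | symm _ _ _ ih => exact ih.symm
  | trans _ _ _ _ _ ih₁ ih₂ => exact ih₁.trans _ _ _ ih₂

theorem IsReduced.of_length_eq {u v : List B} (hu : cs.IsReduced u)
    (h : cs.wordProd u = cs.wordProd v) (hl : v.length = u.length) : cs.IsReduced v := by
  rw [IsReduced, ← h, hl]; exact hu

theorem IsReduced.length_eq {u v : List B} (hu : cs.IsReduced u) (hv : cs.IsReduced v)
    (h : cs.wordProd u = cs.wordProd v) : u.length = v.length := by
  rw [← hu.eq, ← hv.eq, h]

theorem IsReduced.of_append_left {u v : List B} (h : cs.IsReduced (u ++ v)) : cs.IsReduced u := by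
  simpa using h.take u.length

theorem IsReduced.isRightDescent {u : List B} {s : B} (h : cs.IsReduced (u ++ [s])) :
    cs.IsRightDescent (cs.wordProd (u ++ [s])) s := by
  rw [IsRightDescent, h.eq, wordProd_append, wordProd_singleton, mul_assoc,
    simple_mul_simple_self, mul_one, (IsReduced.of_append_left cs h).eq]
  simp

theorem exists_isReduced_append_alternatingWord
    (hord : ∀ s t k, 0 < k → k < M s t → (cs.simple s * cs.simple t) ^ k ≠ 1)
    {w : W} (k : ℕ) : ∀ {s t : B}, cs.IsRightDescent w s → cs.IsRightDescent w t → k ≤ M s t →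
    ∃ x, cs.IsReduced (x ++ alternatingWord s t k) ∧
      cs.wordProd (x ++ alternatingWord s t k) = w := by
  induction k with
  | zero =>
    intro s t _ _ _
    obtain ⟨u, hu, rfl⟩ := cs.exists_isReduced w
    exact ⟨u, by simpa [alternatingWord] using hu, by simp [alternatingWord]⟩
  | succ k ih =>
    intro s t hs ht hk
    obtain ⟨x, hx, rfl⟩ := ih ht hs (by rw [M.symmetric]; omega)
    obtain ⟨j, hj, he⟩ := cs.exists_eraseIdx_of_isRightDescent ht
    have hlen : (x ++ alternatingWord t s k).length = x.length + k := by simp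
    rw [hlen] at hj
    rcases lt_or_ge j x.length with hjx | hjx
    · rw [List.eraseIdx_append_of_lt_length hjx] at he
      have hprod : cs.wordProd (x.eraseIdx j ++ alternatingWord s t (k + 1)) =
          cs.wordProd (x ++ alternatingWord t s k) := by
        rw [alternatingWord_succ, List.concat_eq_append, ← List.append_assoc, wordProd_append,
          ← he, wordProd_singleton, mul_assoc, simple_mul_simple_self, mul_one]
      refine ⟨x.eraseIdx j, IsReduced.of_length_eq cs hx hprod.symm ?_, hprod⟩
      simp [List.length_eraseIdx, hjx]
      omega
    · exfalso
      rw [List.eraseIdx_append_of_length_le hjx, wordProd_append, wordProd_append, mul_assoc,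
        mul_right_inj] at he
      have hred := cs.isReduced_alternatingWord hord s t hk
      have h1 := hred.eq
      rw [alternatingWord_succ, wordProd_concat, he] at h1
      have h2 := cs.length_wordProd_le ((alternatingWord t s k).eraseIdx (j - x.length))
      rw [h1] at h2
      simp [List.length_eraseIdx] at h2
      split_ifs at h2 <;> omega

/-- **Matsumoto's theorem**: two reduced words of the same element are related by braid moves. -/
theorem IsReduced.braidEquiv
    (hord : ∀ s t k, 0 < k → k < M s t → (cs.simple s * cs.simple t) ^ k ≠ 1)
    {u v : List B} (hu : cs.IsReduced u) (hv : cs.IsReduced v)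
    (h : cs.wordProd u = cs.wordProd v) (hM : ∀ s t, M s t ≠ 0) :
    Relation.EqvGen (BraidMove M) u v := by
  induction hn : u.length generalizing u v with
  | zero =>
    have h1 := IsReduced.length_eq cs hu hv h
    rw [List.length_eq_zero_iff] at hn
    subst hn
    rw [List.length_nil, eq_comm, List.length_eq_zero_iff] at h1
    subst h1
    exact .refl _
  | succ N ih =>
    have step : ∀ (u v : List B) (s : B), cs.IsReduced (u ++ [s]) → cs.IsReduced (v ++ [s]) →
        cs.wordProd (u ++ [s]) = cs.wordProd (v ++ [s]) → u.length = N →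
        Relation.EqvGen (BraidMove M) (u ++ [s]) (v ++ [s]) := by
      intro u v s hu hv h hN
      refine braidEquiv_append_right (ih (IsReduced.of_append_left cs hu)
        (IsReduced.of_append_left cs hv) ?_ hN) _
      simpa [wordProd_append] using h
    have hl := IsReduced.length_eq cs hu hv h
    rcases List.eq_nil_or_concat' u with rfl | ⟨u, s, rfl⟩
    · simp at hn
    rcases List.eq_nil_or_concat' v with rfl | ⟨v, t, rfl⟩
    · simp at hl
    have hs := IsReduced.isRightDescent cs hu
    have ht := IsReduced.isRightDescent cs hv
    rw [← h] at ht
    obtain ⟨m, hm⟩ := Nat.exists_eq_succ_of_ne_zero (hM s t)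
    obtain ⟨x, hx, hxw⟩ := cs.exists_isReduced_append_alternatingWord hord (M s t) hs ht le_rfl
    have hb : BraidMove M (x ++ braidWord M s t) (x ++ braidWord M t s) :=
      ⟨x, [], s, t, by simp, by simp⟩
    have hy := IsReduced.of_length_eq cs hx (hb.wordProd_eq cs) (by simp [M.symmetric])
    have e1 : x ++ braidWord M s t = (x ++ alternatingWord t s m) ++ [t] := by
      rw [braidWord, hm, alternatingWord_succ]; simp
    have e2 : x ++ braidWord M t s = (x ++ alternatingWord s t m) ++ [s] := by
      rw [braidWord, M.symmetric, hm, alternatingWord_succ]; simp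
    have hyw := (hb.wordProd_eq cs).symm.trans hxw
    have hvx := hxw.trans h
    have hlx := IsReduced.length_eq cs hx hv hvx
    change cs.IsReduced (x ++ braidWord M s t) at hx
    change cs.wordProd (x ++ braidWord M s t) = _ at hxw hvx
    rw [e2] at hy hyw
    rw [e1] at hx hxw hvx
    have h1 := step _ _ s hu hy hyw.symm (by simpa using hn)
    have h2 := step _ _ t hx hv hvx (by
      have := IsReduced.length_eq cs hx hv hvx
      simp at this hn hl
      simp; omega)
    rw [← e2] at h1
    rw [← e1] at h2
    exact (h1.trans _ _ _ (.symm _ _ (.rel _ _ hb))).trans _ _ _ h2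

end Matsumoto

end CoxeterSystem

section CommEquiv

variable {B : Type*} {M : CoxeterMatrix B}

namespace CommEquiv

theorem refl (u : List B) : CommEquiv M u u := Relation.EqvGen.refl u

theorem symm {u v : List B} (h : CommEquiv M u v) : CommEquiv M v u := Relation.EqvGen.symm _ _ h

theorem trans {u v w : List B} (h : CommEquiv M u v) (h' : CommEquiv M v w) : CommEquiv M u w :=
  Relation.EqvGen.trans _ _ _ h h'

theorem of_map {B' : Type*} {M' : CoxeterMatrix B'} {f : List B → List B'}
    (hf : ∀ u v, CommMove M u v → CommEquiv M' (f u) (f v)) {u v : List B}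
    (h : CommEquiv M u v) : CommEquiv M' (f u) (f v) := by
  induction h with
  | rel _ _ h => exact hf _ _ h
  | refl _ => exact .refl _
  | symm _ _ _ ih => exact ih.symm
  | trans _ _ _ _ _ ih₁ ih₂ => exact ih₁.trans ih₂

theorem eq_of {α : Sort*} {f : List B → α} (hf : ∀ u v, CommMove M u v → f u = f v) {u v : List B}
    (h : CommEquiv M u v) : f u = f v := by
  induction h with
  | rel _ _ h => exact hf _ _ h
  | refl _ => rfl
  | symm _ _ _ ih => exact ih.symm
  | trans _ _ _ _ _ ih₁ ih₂ => exact ih₁.trans ih₂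

theorem append_left (x : List B) {u v : List B} (h : CommEquiv M u v) :
    CommEquiv M (x ++ u) (x ++ v) := by
  refine of_map (f := fun u => x ++ u) ?_ h
  rintro _ _ ⟨y, z, a, b, hab, rfl, rfl⟩
  exact .rel _ _ ⟨x ++ y, z, a, b, hab, by simp, by simp⟩

theorem append_right {u v : List B} (h : CommEquiv M u v) (x : List B) :
    CommEquiv M (u ++ x) (v ++ x) := by
  refine of_map (f := fun u => u ++ x) ?_ h
  rintro _ _ ⟨y, z, a, b, hab, rfl, rfl⟩
  exact .rel _ _ ⟨y, z ++ x, a, b, hab, by simp, by simp⟩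

theorem cons (a : B) {u v : List B} (h : CommEquiv M u v) : CommEquiv M (a :: u) (a :: v) :=
  append_left [a] h

theorem reverse {u v : List B} (h : CommEquiv M u v) : CommEquiv M u.reverse v.reverse := by
  refine of_map (f := List.reverse) ?_ h
  rintro _ _ ⟨y, z, a, b, hab, rfl, rfl⟩
  exact .rel _ _ ⟨z.reverse, y.reverse, b, a, by rwa [M.symmetric], by simp, by simp⟩

theorem perm {u v : List B} (h : CommEquiv M u v) : u.Perm v := by
  induction h with
  | rel _ _ h =>
    obtain ⟨y, z, a, b, hab, rfl, rfl⟩ := h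
    exact (List.Perm.swap b a z).append_left y
  | refl _ => rfl
  | symm _ _ _ ih => exact ih.symm
  | trans _ _ _ _ _ ih₁ ih₂ => exact ih₁.trans ih₂

theorem filter_eq {p : B → Bool} (hp : ∀ a b, M a b = 2 → p a → ¬ p b) {u v : List B}
    (h : CommEquiv M u v) : u.filter p = v.filter p := by
  refine eq_of (f := List.filter p) ?_ h
  rintro _ _ ⟨y, z, a, b, hab, rfl, rfl⟩
  have := hp a b hab
  by_cases ha : p a
  · simp [List.filter_cons, this ha]
  · simp [List.filter_cons, ha]

/-- A letter can be moved across a word all of whose letters commute with it. -/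
theorem cons_append_singleton {a : B} {x : List B} (h : ∀ b ∈ x, M a b = 2) :
    CommEquiv M (a :: x) (x ++ [a]) := by
  induction x with
  | nil => exact .refl _
  | cons b x ih =>
    have h1 : CommEquiv M (a :: b :: x) (b :: a :: x) :=
      .rel _ _ ⟨[], x, a, b, h b (by simp), rfl, rfl⟩
    exact h1.trans ((ih fun c hc => h c (by simp [hc])).cons b)

theorem wordProd_eq {W : Type*} [Group W] (cs : CoxeterSystem M W) {u v : List B}
    (h : CommEquiv M u v) : cs.wordProd u = cs.wordProd v := by
  refine eq_of (f := cs.wordProd) ?_ h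
  rintro _ _ ⟨y, z, a, b, hab, rfl, rfl⟩
  have h2 := cs.wordProd_braidWord_eq a b
  rw [braidWord, braidWord, M.symmetric b a, hab] at h2
  simp only [alternatingWord, List.concat_eq_append, List.nil_append, wordProd_append,
    wordProd_singleton] at h2
  simp only [wordProd_append, wordProd_cons, ← mul_assoc]
  rw [mul_assoc (cs.wordProd y), h2]
  simp only [mul_assoc]

theorem length_eq {u v : List B} (h : CommEquiv M u v) : u.length = v.length := h.perm.length_eq

end CommEquiv

/-- A word is fully commutative if no word of its commutation class has a factor `ss` or a factor
that is a braid word of length at least `3`. -/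
def IsFCWord (M : CoxeterMatrix B) (u : List B) : Prop :=
  ∀ v, CommEquiv M u v → (∀ s, ¬ [s, s] <:+: v) ∧ ∀ s t, 3 ≤ M s t → ¬ braidWord M s t <:+: v

theorem IsFCWord.of_commEquiv {u v : List B} (hu : IsFCWord M u) (h : CommEquiv M u v) :
    IsFCWord M v := fun w hw => hu w (h.trans hw)

theorem IsFCWord.of_factor {u v : List B} (hv : IsFCWord M v) (h : u <:+: v) : IsFCWord M u := by
  obtain ⟨x, y, rfl⟩ := h
  intro w hw
  have h1 := hv _ ((hw.append_left x).append_right y)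
  have h2 : w <:+: x ++ w ++ y := ⟨x, y, rfl⟩
  exact ⟨fun s hs => h1.1 s (hs.trans h2), fun s t hst hs => h1.2 s t hst (hs.trans h2)⟩

theorem reverse_alternatingWord (s t : B) (m : ℕ) :
    (alternatingWord s t m).reverse = alternatingWord s t m ∨
      (alternatingWord s t m).reverse = alternatingWord t s m := by
  obtain ⟨k, rfl | rfl⟩ := Nat.even_or_odd' m
  · exact .inr (reverse_alternatingWord_two_mul s t k)
  · left
    have h1 := alternatingWord_succ' s t (2 * k)
    rw [if_pos (by simp)] at h1
    rw [h1, List.reverse_cons, reverse_alternatingWord_two_mul, ← h1, alternatingWord_succ,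
      List.concat_eq_append]

theorem IsFCWord.reverse {u : List B} (hu : IsFCWord M u) : IsFCWord M u.reverse := by
  intro v hv
  have h := hu v.reverse (by simpa using hv.reverse)
  refine ⟨fun s hs => h.1 s ?_, fun s t hst hs => ?_⟩
  · simpa using List.reverse_infix.mpr hs
  · rw [← List.reverse_infix, braidWord] at hs
    rcases reverse_alternatingWord s t (M s t) with h' | h' <;> rw [h'] at hs
    · exact h.2 s t hst hs
    · exact h.2 t s (by rwa [M.symmetric]) (by rwa [braidWord, M.symmetric])

theorem mem_of_mem_alternatingWord {s t x : B} {m : ℕ} (hx : x ∈ alternatingWord s t m) :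
    x = s ∨ x = t := by
  induction m generalizing s t with
  | zero => simp [alternatingWord] at hx
  | succ m ih =>
    rw [alternatingWord_succ] at hx
    simp only [List.concat_eq_append, List.mem_append, List.mem_singleton] at hx
    rcases hx with hx | hx
    · exact (ih hx).symm
    · exact .inr hx

variable {W : Type*} [Group W] (cs : CoxeterSystem M W)

theorem not_isReduced_of_factor {s : B} {v : List B} (h : [s, s] <:+: v) : ¬ cs.IsReduced v := by
  obtain ⟨x, y, rfl⟩ := h
  intro hr
  have h1 := cs.length_wordProd_le (x ++ y)
  have h2 : cs.wordProd (x ++ [s, s] ++ y) = cs.wordProd (x ++ y) := by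
    simp [wordProd_append, wordProd_cons]
  rw [CoxeterSystem.IsReduced, h2] at hr
  simp at hr h1
  omega

/-- Reduced words of fully commutative elements are fully commutative words. -/
theorem isFCWord_of_isFullyCommutative {u : List B} (hu : cs.IsReduced u)
    (h : IsFullyCommutative cs (cs.wordProd u)) : IsFCWord M u := by
  classical
  intro v hv
  have hvr := CoxeterSystem.IsReduced.of_length_eq cs hu (hv.wordProd_eq cs) hv.length_eq.symm
  refine ⟨fun s hs => not_isReduced_of_factor cs hs hvr, ?_⟩
  rintro s t hst ⟨x, y, rfl⟩
  have hb : BraidMove M (x ++ braidWord M s t ++ y) (x ++ braidWord M t s ++ y) :=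
    ⟨x, y, s, t, rfl, rfl⟩
  have hr := CoxeterSystem.IsReduced.of_length_eq cs hvr (hb.wordProd_eq cs) (by simp [M.symmetric])
  have hc := h _ _ hvr (hv.wordProd_eq cs).symm hr
    ((hb.wordProd_eq cs).symm.trans (hv.wordProd_eq cs).symm)
  have hp : ∀ a b, M a b = 2 → decide (a = s ∨ a = t) → ¬ decide (b = s ∨ b = t) := by
    intro a b hab ha hb
    simp only [decide_eq_true_eq] at ha hb
    have h1 := M.diagonal s
    have h2 := M.diagonal t
    have h3 := M.symmetric s t
    rcases ha with rfl | rfl <;> rcases hb with rfl | rfl <;> omega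
  have hf := hc.filter_eq hp
  have e1 : (braidWord M s t).filter (fun a => decide (a = s ∨ a = t)) = braidWord M s t :=
    List.filter_eq_self.mpr fun a ha => by simpa using mem_of_mem_alternatingWord ha
  have e2 : (braidWord M t s).filter (fun a => decide (a = s ∨ a = t)) = braidWord M t s :=
    List.filter_eq_self.mpr fun a ha => by simpa using (mem_of_mem_alternatingWord ha).symm
  rw [List.filter_append, List.filter_append, List.filter_append, List.filter_append, e1, e2,
    List.append_cancel_right_eq, List.append_cancel_left_eq] at hf
  obtain ⟨k, hk⟩ : ∃ k, M s t = k + 1 := ⟨M s t - 1, by omega⟩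
  rw [braidWord, braidWord, M.symmetric t s, hk, alternatingWord_succ, alternatingWord_succ,
    List.concat_eq_append, List.concat_eq_append] at hf
  have := (List.append_inj' hf rfl).2
  simp only [List.cons.injEq, and_true] at this
  subst this
  have := M.diagonal t
  omega

theorem IsFCWord.commEquiv_of_braidEquiv {u v : List B} (h : Relation.EqvGen (BraidMove M) u v)
    (hu : IsFCWord M u) : CommEquiv M u v := by
  suffices h : (IsFCWord M u → CommEquiv M u v) ∧ (IsFCWord M v → CommEquiv M u v) from h.1 hu
  clear hu
  induction h with
  | rel u v h =>
    obtain ⟨x, y, s, t, rfl, rfl⟩ := h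
    obtain hm | hm | hm | hm : 3 ≤ M s t ∨ M s t = 0 ∨ M s t = 1 ∨ M s t = 2 := by omega
    · refine ⟨fun h => ?_, fun h => ?_⟩
      · exact ((h _ (.refl _)).2 s t hm ⟨x, y, rfl⟩).elim
      · exact ((h _ (.refl _)).2 t s (by rwa [M.symmetric]) ⟨x, y, rfl⟩).elim
    · have : CommEquiv M (x ++ braidWord M s t ++ y) (x ++ braidWord M t s ++ y) := by
        rw [braidWord, braidWord, M.symmetric t s, hm]
        exact .refl _
      exact ⟨fun _ => this, fun _ => this⟩
    · obtain rfl : s = t := by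
        by_contra hst
        exact M.off_diagonal s t hst hm
      exact ⟨fun _ => .refl _, fun _ => .refl _⟩
    · have : CommEquiv M (x ++ braidWord M s t ++ y) (x ++ braidWord M t s ++ y) := by
        rw [braidWord, braidWord, M.symmetric t s, hm]
        exact .rel _ _ ⟨x, y, s, t, hm, by simp [alternatingWord], by simp [alternatingWord]⟩
      exact ⟨fun _ => this, fun _ => this⟩
  | refl _ => exact ⟨fun _ => .refl _, fun _ => .refl _⟩
  | symm _ _ _ ih => exact ⟨fun h => (ih.2 h).symm, fun h => (ih.1 h).symm⟩
  | trans _ _ _ _ _ ih₁ ih₂ =>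
    refine ⟨fun h => ?_, fun h => ?_⟩
    · have := ih₁.1 h
      exact this.trans (ih₂.1 (h.of_commEquiv this))
    · have := ih₂.2 h
      exact (ih₁.2 (h.of_commEquiv this.symm)).trans this

theorem IsFCWord.isReduced
    (hord : ∀ s t k, 0 < k → k < M s t → (cs.simple s * cs.simple t) ^ k ≠ 1)
    (hM : ∀ s t, M s t ≠ 0)
    {u : List B} (hu : IsFCWord M u) : cs.IsReduced u := by
  induction u using List.reverseRecOn with
  | nil => simp [CoxeterSystem.IsReduced]
  | append_singleton u s ih =>
    have hu' : IsFCWord M u := hu.of_factor ⟨[], [s], rfl⟩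
    have hr := ih hu'
    rcases cs.length_mul_simple (cs.wordProd u) s with h | h
    · rw [CoxeterSystem.IsReduced, wordProd_append, wordProd_singleton, h, hr.eq]
      simp
    · exfalso
      obtain ⟨y, hy, hys⟩ := cs.exists_isReduced (cs.wordProd u * cs.simple s)
      have hprod : cs.wordProd u = cs.wordProd (y ++ [s]) := by
        rw [wordProd_append, ← hys, wordProd_singleton, mul_assoc, simple_mul_simple_self, mul_one]
      have hlen : (y ++ [s]).length = u.length := by
        rw [hys, hy.eq, hr.eq] at h
        simpa using h
      have hy' := CoxeterSystem.IsReduced.of_length_eq cs hr hprod hlen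
      have hc := hu'.commEquiv_of_braidEquiv
        (CoxeterSystem.IsReduced.braidEquiv cs hord hr hy' hprod hM)
      exact (hu _ (hc.append_right [s])).1 s ⟨y, [], by simp⟩

/-- Fully commutative words with the same product are commutation-equivalent. -/
theorem IsFCWord.commEquiv
    (hord : ∀ s t k, 0 < k → k < M s t → (cs.simple s * cs.simple t) ^ k ≠ 1)
    (hM : ∀ s t, M s t ≠ 0)
    {u v : List B} (hu : IsFCWord M u) (hv : cs.IsReduced v)
    (h : cs.wordProd u = cs.wordProd v) : CommEquiv M u v :=
  hu.commEquiv_of_braidEquiv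
    (CoxeterSystem.IsReduced.braidEquiv cs hord (IsFCWord.isReduced cs hord hM hu) hv h hM)

/-- Fully commutative involutions are the products of the fully commutative words that are
commutation-equivalent to their reversal. -/
theorem isFCInvolution_and_length_eq_iff
    (hord : ∀ s t k, 0 < k → k < M s t → (cs.simple s * cs.simple t) ^ k ≠ 1)
    (hM : ∀ s t, M s t ≠ 0)
    (w : W) (L : ℕ) :
    (IsFCInvolution cs w ∧ cs.length w = L) ↔
      ∃ u, IsFCWord M u ∧ CommEquiv M u u.reverse ∧ u.length = L ∧ cs.wordProd u = w := by
  constructor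
  · rintro ⟨⟨hw, hinv⟩, hL⟩
    obtain ⟨u, hu, rfl⟩ := cs.exists_isReduced w
    have hfc := isFCWord_of_isFullyCommutative cs hu hw
    refine ⟨u, hfc, ?_, hu.eq ▸ hL, rfl⟩
    refine IsFCWord.commEquiv cs hord hM hfc hu.reverse ?_
    rw [wordProd_reverse]
    exact eq_inv_of_mul_eq_one_left hinv
  · rintro ⟨u, hu, hrev, hL, rfl⟩
    have hr := IsFCWord.isReduced cs hord hM hu
    refine ⟨⟨fun a b ha hau hb hbu => ?_, ?_⟩, hr.eq.trans hL⟩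
    · exact (IsFCWord.commEquiv cs hord hM hu ha hau.symm).symm.trans
        (IsFCWord.commEquiv cs hord hM hu hb hbu.symm)
    · have := hrev.wordProd_eq cs
      rw [wordProd_reverse] at this
      rw [mul_eq_one_iff_eq_inv]
      exact this

end CommEquiv

section ReflectionRepresentation

variable {V : Type*} [AddCommGroup V] {f g : V →ₗ[ℤ] ℤ} {x y : V}

theorem reflection_mul_reflection_pow_two_eq_one (hf : f x = 2) (hg : g y = 2) (h : f y = 0)
    (h' : g x = 0) : (Module.reflection hf * Module.reflection hg) ^ 2 = 1 := by
  ext v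
  simp only [pow_succ, pow_zero, one_mul, LinearEquiv.mul_apply, Module.reflection_apply, map_sub,
    map_smul, hf, hg, h, h', LinearEquiv.coe_one, id]
  module

theorem reflection_mul_reflection_pow_three_eq_one (hf : f x = 2) (hg : g y = 2) (h : f y = -1)
    (h' : g x = -1) : (Module.reflection hf * Module.reflection hg) ^ 3 = 1 := by
  ext v
  simp only [pow_succ, pow_zero, one_mul, LinearEquiv.mul_apply, Module.reflection_apply, map_sub,
    map_smul, hf, hg, h, h', LinearEquiv.coe_one, id]
  module

theorem reflection_mul_reflection_pow_four_eq_one (hf : f x = 2) (hg : g y = 2)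
    (h : f y = -1 ∧ g x = -2 ∨ f y = -2 ∧ g x = -1) :
    (Module.reflection hf * Module.reflection hg) ^ 4 = 1 := by
  ext v
  rcases h with ⟨h, h'⟩ | ⟨h, h'⟩ <;>
  · simp only [pow_succ, pow_zero, one_mul, LinearEquiv.mul_apply, Module.reflection_apply, map_sub,
      map_smul, hf, hg, h, h', LinearEquiv.coe_one, id]
    module

/-- If `x` and `y` are part of a basis with dual coordinates `d` and `e`, the product of the two
reflections has order at least the one predicted by the pairings. -/
theorem reflection_mul_reflection_pow_ne_one (hf : f x = 2) (hg : g y = 2) {d e : V →ₗ[ℤ] ℤ}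
    (hx : d x = 1) (hy : d y = 0) (hx' : e x = 0) (hy' : e y = 1) {m k : ℕ} (hk : 0 < k) (hkm : k < m)
    (h : m = 2 ∧ f y = 0 ∧ g x = 0 ∨ m = 3 ∧ f y = -1 ∧ g x = -1 ∨
      m = 4 ∧ f y = -1 ∧ g x = -2 ∨ m = 4 ∧ f y = -2 ∧ g x = -1) :
    (Module.reflection hf * Module.reflection hg) ^ k ≠ 1 := by
  intro he
  have h1 : d (((Module.reflection hf * Module.reflection hg) ^ k) x) = d x := by rw [he]; rfl
  have h2 : e (((Module.reflection hf * Module.reflection hg) ^ k) x) = e x := by rw [he]; rfl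
  rcases h with ⟨rfl, h, h'⟩ | ⟨rfl, h, h'⟩ | ⟨rfl, h, h'⟩ | ⟨rfl, h, h'⟩ <;>
  interval_cases k <;>
  simp [pow_succ, LinearEquiv.mul_apply, Module.reflection_apply, hf, hg, h, h', hx, hy,
    hx', hy'] at h1 h2

end ReflectionRepresentation

section AffineC

variable {n : ℕ}

/-- Adjacency in the path `0, 1, …, n`. -/
def Adj (a b : Fin (n + 1)) : Prop := (a : ℕ) + 1 = b ∨ (b : ℕ) + 1 = a

/-- The two ends of the path `0, 1, …, n`. -/
def IsEnd (a : Fin (n + 1)) : Prop := (a : ℕ) = 0 ∨ (a : ℕ) = n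

theorem Adj.symm {a b : Fin (n + 1)} (h : Adj a b) : Adj b a := Or.symm h

theorem Adj.ne {a b : Fin (n + 1)} (h : Adj a b) : a ≠ b := by
  rintro rfl
  rcases h with h | h <;> omega

theorem affineC_apply (a b : Fin (n + 1)) : affineC n a b =
    if (a : ℕ) = b then 1 else if (a : ℕ) + 1 = b ∨ (b : ℕ) + 1 = a then
      (if (a : ℕ) = 0 ∨ (b : ℕ) = 0 ∨ (a : ℕ) = n ∨ (b : ℕ) = n then 4 else 3) else 2 := rfl

theorem affineC_eq_two_iff {a b : Fin (n + 1)} : affineC n a b = 2 ↔ a ≠ b ∧ ¬ Adj a b := by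
  rw [affineC_apply, Adj, ne_eq, Fin.ext_iff]
  split_ifs <;> simp [*]

theorem affineC_of_adj {a b : Fin (n + 1)} (h : Adj a b) :
    affineC n a b = 4 ∧ (IsEnd a ∨ IsEnd b) ∨ affineC n a b = 3 ∧ ¬ IsEnd a ∧ ¬ IsEnd b := by
  have hab := h.ne
  rw [Adj] at h
  rw [ne_eq, Fin.ext_iff] at hab
  rw [affineC_apply, if_neg hab, if_pos h, IsEnd, IsEnd]
  split_ifs <;> omega

theorem affineC_ne_zero (a b : Fin (n + 1)) : affineC n a b ≠ 0 := by
  rw [affineC_apply]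
  split_ifs <;> simp

/-- A Cartan matrix of affine type `C`. -/
def cartanC (n : ℕ) (a b : Fin (n + 1)) : ℤ :=
  if a = b then 2 else if (a : ℕ) + 1 = b ∨ (b : ℕ) + 1 = a then
    (if (a : ℕ) = 0 ∨ (a : ℕ) = n then -2 else -1) else 0

theorem cartanC_cases (hn : 2 ≤ n) {a b : Fin (n + 1)} (hab : a ≠ b) :
    affineC n a b = 2 ∧ cartanC n a b = 0 ∧ cartanC n b a = 0 ∨
    affineC n a b = 3 ∧ cartanC n a b = -1 ∧ cartanC n b a = -1 ∨
    affineC n a b = 4 ∧ cartanC n a b = -1 ∧ cartanC n b a = -2 ∨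
    affineC n a b = 4 ∧ cartanC n a b = -2 ∧ cartanC n b a = -1 := by
  have hab' := hab
  rw [ne_eq, Fin.ext_iff] at hab'
  rw [affineC_apply, cartanC, cartanC, if_neg hab', if_neg hab, if_neg (Ne.symm hab)]
  split_ifs <;> omega

/-- The linear functional given by a row of the Cartan matrix. -/
noncomputable def cartanCForm (a : Fin (n + 1)) : (Fin (n + 1) → ℤ) →ₗ[ℤ] ℤ :=
  ∑ b, cartanC n a b • LinearMap.proj b

theorem cartanCForm_single (a b : Fin (n + 1)) :
    cartanCForm a (Pi.single b 1) = cartanC n a b := by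
  simp [cartanCForm, LinearMap.sum_apply, Pi.single_apply]

theorem cartanCForm_single_self (a : Fin (n + 1)) : cartanCForm a (Pi.single a 1) = 2 := by
  simp [cartanCForm_single, cartanC]

theorem affineC_isLiftable (hn : 2 ≤ n) : (affineC n).IsLiftable
    (fun a => Module.reflection (cartanCForm_single_self a)) := by
  intro a b
  by_cases hab : a = b
  · subst hab
    rw [(affineC n).diagonal, pow_one]
    ext1 v
    exact Module.involutive_reflection _ v
  rcases cartanC_cases hn hab with ⟨h, h1, h2⟩ | ⟨h, h1, h2⟩ | ⟨h, h1, h2⟩ | ⟨h, h1, h2⟩ <;>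
  rw [h]
  · apply reflection_mul_reflection_pow_two_eq_one <;> rwa [cartanCForm_single]
  · apply reflection_mul_reflection_pow_three_eq_one <;> rwa [cartanCForm_single]
  all_goals
    apply reflection_mul_reflection_pow_four_eq_one
    simp [cartanCForm_single, h1, h2]

theorem affineC_simple_mul_simple_pow_ne_one (hn : 2 ≤ n) (a b : Fin (n + 1)) (k : ℕ) (hk : 0 < k)
    (hkm : k < affineC n a b) :
    ((affineC n).toCoxeterSystem.simple a * (affineC n).toCoxeterSystem.simple b) ^ k ≠ 1 := by
  by_cases hab : a = b
  · subst hab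
    rw [(affineC n).diagonal] at hkm
    omega
  intro h
  have h1 := congrArg ((affineC n).toCoxeterSystem.lift ⟨_, affineC_isLiftable hn⟩) h
  rw [map_pow, map_mul, lift_apply_simple, lift_apply_simple, map_one] at h1
  refine reflection_mul_reflection_pow_ne_one _ _ (d := LinearMap.proj a)
    (e := LinearMap.proj b) (by simp) (by simp [hab]) (by simp [hab]) (by simp) hk hkm ?_ h1
  simpa only [cartanCForm_single] using cartanC_cases hn hab

theorem Adj.eq_of_isEnd {a b c : Fin (n + 1)} (hb : Adj a b) (hc : Adj a c) (ha : IsEnd a) :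
    b = c := by
  rw [Fin.ext_iff]
  unfold Adj IsEnd at *
  omega

theorem Adj.eq_or_eq {a b c d : Fin (n + 1)} (hb : Adj a b) (hc : Adj a c) (hd : Adj a d)
    (hbc : b ≠ c) : d = b ∨ d = c := by
  rw [ne_eq, Fin.ext_iff] at hbc
  rw [Fin.ext_iff, Fin.ext_iff]
  unfold Adj at *
  omega

theorem IsFCWord.not_square {x y : List (Fin (n + 1))} {a : Fin (n + 1)} :
    ¬ IsFCWord (affineC n) (x ++ a :: a :: y) :=
  fun h => (h _ (.refl _)).1 a ⟨x, y, by simp⟩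

theorem IsFCWord.isEnd_or_isEnd {x y : List (Fin (n + 1))} {a b : Fin (n + 1)} (hab : Adj a b)
    (h : IsFCWord (affineC n) (x ++ a :: b :: a :: y)) : IsEnd a ∨ IsEnd b := by
  rcases affineC_of_adj hab with h1 | h1
  · exact h1.2
  · have h2 := (h _ (.refl _)).2 b a (by rw [(affineC n).symmetric]; omega)
    rw [braidWord, (affineC n).symmetric, h1.1] at h2
    exact (h2 ⟨x, y, by simp [alternatingWord]⟩).elim

theorem IsFCWord.not_alternating_four {x y : List (Fin (n + 1))} {a b : Fin (n + 1)}
    (hab : Adj a b) : ¬ IsFCWord (affineC n) (x ++ a :: b :: a :: b :: y) := by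
  intro h
  rcases affineC_of_adj hab with h1 | h1
  · have h2 := (h _ (.refl _)).2 a b (by omega)
    rw [braidWord, h1.1] at h2
    exact h2 ⟨x, y, by simp [alternatingWord]⟩
  · rcases h.isEnd_or_isEnd hab with h | h
    exacts [h1.2.1 h, h1.2.2 h]

/-- Words that move along the path `0, 1, …, n`, turning around only at the ends. -/
def IsZig (z : List (Fin (n + 1))) : Prop :=
  (∀ a b, [a, b] <:+: z → Adj a b) ∧ ∀ a b, [a, b, a] <:+: z → IsEnd b

namespace IsZig

theorem of_factor {z z' : List (Fin (n + 1))} (hz : IsZig z) (h : z' <:+: z) : IsZig z' :=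
  ⟨fun a b hab => hz.1 a b (hab.trans h), fun a b hab => hz.2 a b (hab.trans h)⟩

theorem reverse {z : List (Fin (n + 1))} (hz : IsZig z) : IsZig z.reverse := by
  refine ⟨fun a b hab => (hz.1 b a ?_).symm, fun a b hab => hz.2 a b ?_⟩ <;>
  simpa using List.reverse_infix.mpr hab

theorem adj {x y : List (Fin (n + 1))} {a b : Fin (n + 1)} (hz : IsZig (x ++ a :: b :: y)) :
    Adj a b := hz.1 a b ⟨x, y, by simp⟩

theorem isEnd {x y : List (Fin (n + 1))} {a b : Fin (n + 1)}
    (hz : IsZig (x ++ a :: b :: a :: y)) : IsEnd b := hz.2 a b ⟨x, y, by simp⟩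

theorem append_singleton {x : List (Fin (n + 1))} {a b c : Fin (n + 1)}
    (hz : IsZig (x ++ [a, b])) (hbc : Adj b c) (h : a = c → IsEnd b) :
    IsZig (x ++ [a, b, c]) := by
  have e : x ++ [a, b, c] = (x ++ [a, b]) ++ [c] := by simp
  rw [e]
  refine ⟨fun p q hpq => ?_, fun p q hpq => ?_⟩ <;>
  rcases List.infix_concat_iff.mp hpq with h1 | h1
  · rw [← List.reverse_prefix] at h1
    simp at h1
    obtain ⟨rfl, rfl⟩ := h1
    exact hbc
  · exact hz.1 _ _ h1
  · rw [← List.reverse_prefix] at h1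
    simp at h1
    obtain ⟨rfl, rfl, rfl⟩ := h1
    exact h rfl
  · exact hz.2 _ _ h1

theorem singleton (a : Fin (n + 1)) : IsZig [a] := by
  refine ⟨fun p q h => ?_, fun p q h => ?_⟩ <;> have := h.length_le <;> simp at this

theorem pair {a b : Fin (n + 1)} (h : Adj a b) : IsZig [a, b] := by
  refine ⟨fun p q h' => ?_, fun p q h => ?_⟩
  · have := h'.eq_of_length rfl
    simp at this
    obtain ⟨rfl, rfl⟩ := this
    exact h
  · have := h.length_le
    simp at this

theorem cons {x : List (Fin (n + 1))} {a b c : Fin (n + 1)}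
    (hz : IsZig (b :: c :: x)) (hab : Adj a b) (h : a = c → IsEnd b) :
    IsZig (a :: b :: c :: x) := by
  have h1 : IsZig (x.reverse ++ [c, b]) := by simpa using hz.reverse
  simpa using (h1.append_singleton hab.symm fun h' => h h'.symm).reverse

end IsZig

theorem exists_last_of_exists {α : Type*} {p : α → Prop} {l : List α} (h : ∃ a ∈ l, p a) :
    ∃ x t y, l = x ++ t :: y ∧ p t ∧ ∀ b ∈ y, ¬ p b := by
  induction l with
  | nil => simp at h
  | cons c l ih =>
    by_cases h' : ∃ a ∈ l, p a
    · obtain ⟨x, t, y, rfl, h1⟩ := ih h'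
      exact ⟨c :: x, t, y, rfl, h1⟩
    · obtain ⟨a, ha, hpa⟩ := h
      push Not at h'
      rcases List.mem_cons.mp ha with rfl | ha
      · exact ⟨[], a, l, rfl, hpa, h'⟩
      · exact (h' a ha hpa).elim

theorem IsFCWord.isZig_append_singleton {z : List (Fin (n + 1))} {y : Fin (n + 1)} (hz : IsZig z)
    (h : IsFCWord (affineC n) (z ++ [y])) (hy : y ∈ z) (hy' : IsEnd y → y ∈ z.tail) :
    IsZig (z ++ [y]) := by
  obtain ⟨x, t, w, rfl, ht, hw⟩ := exists_last_of_exists (p := fun t => affineC n y t ≠ 2)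
    ⟨y, hy, by simp⟩
  simp only [not_not] at hw
  have h1 : CommEquiv (affineC n) (x ++ t :: w ++ [y]) (x ++ t :: y :: w) := by
    simpa using (((CommEquiv.cons_append_singleton hw).symm.cons t).append_left x)
  have h2 := h.of_commEquiv h1
  have hyt : y ≠ t := by
    rintro rfl
    exact IsFCWord.not_square h2
  have hty : Adj t y := by
    by_contra hc
    exact ht (affineC_eq_two_iff.mpr ⟨hyt, fun hc' => hc hc'.symm⟩)
  have hyw : y ∉ w := fun h' => by simpa [(affineC n).diagonal] using hw y h'
  have hyx : y ∈ x := by simpa [hyt, hyw] using hy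
  obtain ⟨x', s, rfl⟩ : ∃ x' s, x = x' ++ [s] := by
    rcases x.eq_nil_or_concat' with rfl | h
    · simp at hyx
    · exact h
  have hst : Adj s t := IsZig.adj (x := x') (y := w) (by simpa using hz)
  have hnil : (s ≠ y ∨ IsEnd t) → w = [] := by
    intro hor
    rcases w with _ | ⟨r, w⟩
    · rfl
    have htr : Adj t r := IsZig.adj (x := x' ++ [s]) (y := w) (by simpa using hz)
    have hry : r ≠ y := by
      rintro rfl
      simp at hyw
    by_cases hte : IsEnd t
    · exact (hry (htr.eq_of_isEnd hty hte)).elim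
    · have hsy : s ≠ y := hor.resolve_right hte
      obtain rfl | rfl := hst.symm.eq_or_eq hty htr hsy
      · exact (hte (IsZig.isEnd (x := x') (y := w) (by simpa using hz))).elim
      · exact (hry rfl).elim
  have hfin : (s ≠ y ∨ IsEnd t) → IsZig (x' ++ [s] ++ t :: w ++ [y]) := by
    intro hor
    obtain rfl := hnil hor
    have := IsZig.append_singleton (x := x') (by simpa using hz) hty
      (fun h' => hor.resolve_left fun h'' => h'' h')
    simpa using this
  by_cases hor : s ≠ y ∨ IsEnd t
  · exact hfin hor
  push Not at hor
  obtain ⟨rfl, hte⟩ := hor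
  have hse : IsEnd s := by
    have h3 : IsFCWord (affineC n) (x' ++ s :: t :: s :: w) := by simpa using h2
    exact (h3.isEnd_or_isEnd hst).resolve_right hte
  rcases x'.eq_nil_or_concat' with rfl | ⟨x'', q, rfl⟩
  · have := hy' hse
    simp [hyt, hyw] at this
  · have hqs : Adj q s := IsZig.adj (x := x'') (y := t :: w) (by simpa using hz)
    obtain rfl := hqs.symm.eq_of_isEnd hst hse
    exact (IsFCWord.not_alternating_four (x := x'') (y := w) hqs (by simpa using h2)).elim

/-- Two occurrences of `i` with only smaller letters in between are joined by a zigzag visiting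
all the letters below `i`. -/
theorem IsFCWord.isZig_of_forall_lt {i : Fin (n + 1)} {w : List (Fin (n + 1))}
    (h : IsFCWord (affineC n) (i :: w ++ [i])) (hw : ∀ b ∈ w, b < i) (hi : (i : ℕ) < n) :
    0 < (i : ℕ) ∧ IsZig (i :: w ++ [i]) ∧ ∀ y ≤ i, y ∈ i :: w ++ [i] := by
  obtain ⟨k, hk⟩ : ∃ k, (i : ℕ) = k := ⟨_, rfl⟩
  induction k generalizing i w with
  | zero =>
    obtain rfl : w = [] := by
      refine List.eq_nil_iff_forall_not_mem.mpr fun b hb => ?_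
      have := hw b hb
      rw [Fin.lt_def] at this
      omega
    exact (IsFCWord.not_square (x := []) (y := []) h).elim
  | succ k ih =>
    refine ⟨by omega, ?_⟩
    obtain ⟨j, hj⟩ : ∃ j : Fin (n + 1), (j : ℕ) = k := ⟨⟨k, by omega⟩, rfl⟩
    have hij : Adj i j := .inr (by omega)
    have hjw : j ∈ w := by
      by_contra hjw
      have h1 : ∀ b ∈ w, affineC n i b = 2 := by
        intro b hb
        have h2 := hw b hb
        have h3 : b ≠ j := fun h => hjw (h ▸ hb)
        rw [Fin.lt_def] at h2
        rw [ne_eq, Fin.ext_iff] at h3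
        rw [affineC_eq_two_iff, ne_eq, Fin.ext_iff, Adj]
        omega
      have h2 := ((CommEquiv.cons_append_singleton h1).append_right [i])
      exact IsFCWord.not_square (x := w) (y := []) (by simpa using h.of_commEquiv h2)
    rcases Nat.eq_zero_or_pos k with rfl | hk0
    · have hj' : ∀ b ∈ w, b = j := by
        intro b hb
        have h2 := hw b hb
        rw [Fin.lt_def] at h2
        rw [Fin.ext_iff]
        omega
      obtain rfl : w = [j] := by
        rcases w with _ | ⟨a, _ | ⟨b, w⟩⟩
        · simp at hjw
        · simpa using hj' a
        · obtain rfl := hj' a (by simp)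
          obtain rfl := hj' b (by simp)
          exact (IsFCWord.not_square (x := [i]) (y := w ++ [i]) h).elim
      refine ⟨IsZig.append_singleton (x := []) (IsZig.pair hij) hij.symm fun _ => .inl hj, ?_⟩
      intro y hy
      rw [Fin.le_def] at hy
      simp only [List.cons_append, List.nil_append, List.mem_cons, Fin.ext_iff]
      omega
    have hie : ¬ IsEnd i := by unfold IsEnd; omega
    have hje : ¬ IsEnd j := by unfold IsEnd; omega
    obtain ⟨w₁, w', rfl, hw₁⟩ := List.eq_append_cons_of_mem hjw
    have comm : ∀ x : List (Fin (n + 1)), (∀ b ∈ x, b < i) → j ∉ x → ∀ b ∈ x, affineC n i b = 2 := by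
      intro x hx hjx b hb
      have h2 := hx b hb
      have h3 : b ≠ j := fun h => hjx (h ▸ hb)
      rw [Fin.lt_def] at h2
      rw [ne_eq, Fin.ext_iff] at h3
      rw [affineC_eq_two_iff, ne_eq, Fin.ext_iff, Adj]
      omega
    have hjw' : j ∈ w' := by
      by_contra hjw'
      have h1 := (CommEquiv.cons_append_singleton
        (comm w₁ (fun b hb => hw b (by simp [hb])) hw₁)).append_right (j :: w' ++ [i])
      have h2 := (CommEquiv.cons_append_singleton
        (comm w' (fun b hb => hw b (by simp [hb])) hjw')).symm.append_left (w₁ ++ [i, j])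
      have h3 := h.of_commEquiv ((by simpa using h1 : CommEquiv _ _ _).trans (by simpa using h2))
      rcases h3.isEnd_or_isEnd hij with h4 | h4
      exacts [hie h4, hje h4]
    obtain ⟨w₂, w₃, rfl, hw₂⟩ := List.eq_append_cons_of_mem hjw'
    have hw₂' : ∀ b ∈ w₂, b < j := by
      intro b hb
      have h2 := hw b (by simp [hb])
      have h3 : b ≠ j := fun h => hw₂ (h ▸ hb)
      rw [Fin.lt_def] at h2 ⊢
      rw [ne_eq, Fin.ext_iff] at h3
      omega
    obtain ⟨-, hz, hmem⟩ := ih (i := j) (w := w₂) (h.of_factor ⟨i :: w₁, w₃ ++ [i], by simp⟩) hw₂'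
      (by omega) hj
    have key : ∀ (x : List (Fin (n + 1))) (b : Fin (n + 1)), b < i → (∀ c ∈ x, c < j) →
        IsZig (j :: x ++ [j]) → (∀ y ≤ j, y ∈ j :: x ++ [j]) →
        ¬ IsFCWord (affineC n) ((j :: x ++ [j]) ++ [b]) := by
      intro x b hb hx hz hmem hfc
      rw [Fin.lt_def] at hb
      have hbj : b ≤ j := by rw [Fin.le_def]; omega
      have hz' := IsFCWord.isZig_append_singleton hz hfc (hmem b hbj) (by
        intro hbe
        have h2 := hmem b hbj
        have h3 : b ≠ j := fun h => hje (h ▸ hbe)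
        simpa [h3] using h2)
      rcases x.eq_nil_or_concat' with rfl | ⟨x, c, rfl⟩
      · exact (IsZig.adj (x := []) (y := [b]) hz').ne rfl
      · have hcj : Adj c j := IsZig.adj (x := j :: x) (y := [b]) (by simpa using hz')
        have hjb : Adj j b := IsZig.adj (x := j :: (x ++ [c])) (y := []) (by simpa using hz')
        have hcj' := hx c (by simp)
        obtain rfl : c = b := by
          rw [Fin.lt_def] at hcj'
          rw [Fin.ext_iff]
          unfold Adj at hcj hjb
          omega
        exact hje (IsZig.isEnd (x := j :: x) (y := []) (by simpa using hz'))
    obtain rfl : w₃ = [] := by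
      rcases w₃ with _ | ⟨b, w₃⟩
      · rfl
      · exact (key w₂ b (hw b (by simp)) hw₂' hz hmem
          (h.of_factor ⟨i :: w₁, w₃ ++ [i], by simp⟩)).elim
    obtain rfl : w₁ = [] := by
      rcases w₁.eq_nil_or_concat' with rfl | ⟨w₁, b, rfl⟩
      · rfl
      · have h1 : IsFCWord (affineC n) (b :: j :: w₂ ++ [j]) :=
          h.of_factor ⟨i :: w₁, [i], by simp⟩
        refine (key w₂.reverse b (hw b (by simp)) (by simpa using hw₂') (by simpa using hz.reverse)
          (by simpa using hmem) ?_).elim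
        simpa using h1.reverse
    have hlt : ∀ c ∈ w₂ ++ [j], c ≠ i := by
      intro c hc
      exact (hw c (by simp at hc ⊢; tauto)).ne
    have h1 : IsZig (j :: w₂ ++ [j] ++ [i]) := by
      obtain ⟨x, c, hx⟩ : ∃ x c, j :: w₂ = x ++ [c] := by
        rcases (j :: w₂).eq_nil_or_concat' with h | h
        · simp at h
        · exact h
      have hc : c ≠ i := by
        have : c ∈ j :: w₂ := by simp [hx]
        refine (hw c ?_).ne
        simp at this ⊢
        tauto
      rw [hx] at hz ⊢
      simpa using IsZig.append_singleton (x := x) (a := c) (b := j) (c := i) (by simpa using hz) hij.symm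
        fun h => (hc h).elim
    refine ⟨?_, fun y hy => ?_⟩
    · rcases w₂ with _ | ⟨c, w₂⟩
      · simpa using IsZig.cons (by simpa using h1) hij fun h => (hlt _ (by simp) h.symm).elim
      · simpa using IsZig.cons (by simpa using h1) hij fun h => (hlt _ (by simp) h.symm).elim
    · by_cases hyi : y = i
      · simp [hyi]
      · have : y ≤ j := by
          rw [Fin.ext_iff] at hyi
          rw [Fin.le_def] at hy ⊢
          omega
        have := hmem y this
        simp at this ⊢
        tauto

theorem adj_rev {a b : Fin (n + 1)} : Adj a.rev b.rev ↔ Adj a b := by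
  simp only [Adj, Fin.val_rev]
  omega

theorem isEnd_rev {a : Fin (n + 1)} : IsEnd a.rev ↔ IsEnd a := by
  simp only [IsEnd, Fin.val_rev]
  omega

theorem affineC_rev (a b : Fin (n + 1)) : affineC n a.rev b.rev = affineC n a b := by
  have ha := a.is_lt
  have hb := b.is_lt
  simp only [affineC_apply, Fin.val_rev]
  congr 1
  · rw [eq_iff_iff]; omega
  · congr 1
    · rw [eq_iff_iff]; omega
    · congr 1
      rw [eq_iff_iff]; omega

theorem CommEquiv.map_rev {u v : List (Fin (n + 1))} (h : CommEquiv (affineC n) u v) :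
    CommEquiv (affineC n) (u.map Fin.rev) (v.map Fin.rev) := by
  refine of_map (f := List.map Fin.rev) ?_ h
  rintro _ _ ⟨y, z, a, b, hab, rfl, rfl⟩
  exact .rel _ _ ⟨y.map Fin.rev, z.map Fin.rev, a.rev, b.rev, by rwa [affineC_rev], by simp, by simp⟩

theorem map_rev_map_rev (u : List (Fin (n + 1))) : (u.map Fin.rev).map Fin.rev = u := by
  rw [List.map_map]
  exact (List.map_congr_left fun a _ => Fin.rev_rev a).trans (List.map_id u)

theorem map_alternatingWord {α β : Type*} (f : α → β) (a b : α) (m : ℕ) :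
    (alternatingWord a b m).map f = alternatingWord (f a) (f b) m := by
  induction m generalizing a b with
  | zero => rfl
  | succ m ih => simp [alternatingWord_succ, ih]

theorem IsFCWord.map_rev {u : List (Fin (n + 1))} (h : IsFCWord (affineC n) u) :
    IsFCWord (affineC n) (u.map Fin.rev) := by
  intro v hv
  have h1 := h (v.map Fin.rev) (by simpa only [map_rev_map_rev] using hv.map_rev)
  refine ⟨fun s hs => h1.1 s.rev (by simpa using hs.map Fin.rev), fun s t hst hs => ?_⟩
  refine h1.2 s.rev t.rev (by rwa [affineC_rev]) ?_
  rw [braidWord, affineC_rev, ← map_alternatingWord]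
  exact hs.map Fin.rev

theorem IsZig.map_rev {z : List (Fin (n + 1))} (h : IsZig z) : IsZig (z.map Fin.rev) := by
  refine ⟨fun a b hab => ?_, fun a b hab => ?_⟩
  · rw [← adj_rev]
    exact h.1 _ _ (by simpa only [map_rev_map_rev, List.map] using hab.map Fin.rev)
  · rw [← isEnd_rev]
    exact h.2 a.rev _ (by simpa only [map_rev_map_rev, List.map] using hab.map Fin.rev)

theorem IsZig.of_map_rev {z : List (Fin (n + 1))} (h : IsZig (z.map Fin.rev)) : IsZig z := by
  simpa only [map_rev_map_rev] using h.map_rev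

theorem IsZig.eq_of_commEquiv {u v : List (Fin (n + 1))} (hu : IsZig u)
    (h : CommEquiv (affineC n) u v) : u = v := by
  suffices h : (IsZig u → u = v) ∧ (IsZig v → u = v) from h.1 hu
  clear hu
  induction h with
  | rel u v h =>
    obtain ⟨x, y, a, b, hab, rfl, rfl⟩ := h
    have := (affineC_eq_two_iff.mp hab).2
    exact ⟨fun h => (this h.adj).elim, fun h => (this h.adj.symm).elim⟩
  | refl _ => exact ⟨fun _ => rfl, fun _ => rfl⟩
  | symm _ _ _ ih => exact ⟨fun h => (ih.2 h).symm, fun h => (ih.1 h).symm⟩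
  | trans _ _ _ _ _ ih₁ ih₂ =>
    refine ⟨fun h => ?_, fun h => ?_⟩
    · have := ih₁.1 h
      exact this.trans (ih₂.1 (this ▸ h))
    · have := ih₂.2 h
      exact (ih₁.2 (this ▸ h)).trans this

/-- A word without letters `i` and `i + 1` can be split at `i`. -/
theorem commEquiv_filter_append_filter {i : Fin (n + 1)} {w : List (Fin (n + 1))}
    (h : ∀ b ∈ w, (b : ℕ) ≠ i ∧ (b : ℕ) ≠ i + 1) :
    CommEquiv (affineC n) w (w.filter (· < i) ++ w.filter (¬ · < i)) := by
  induction w with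
  | nil => exact .refl _
  | cons a w ih =>
    have h1 := (ih fun b hb => h b (by simp [hb])).cons a
    by_cases ha : a < i
    · simpa [ha] using h1
    · refine h1.trans ?_
      have h2 : ∀ b ∈ w.filter (· < i), affineC n a b = 2 := by
        intro b hb
        have h3 := h a (by simp)
        simp only [List.mem_filter, decide_eq_true_eq, Fin.lt_def] at hb
        rw [Fin.lt_def] at ha
        rw [affineC_eq_two_iff, Adj, ne_eq, Fin.ext_iff]
        omega
      simpa [ha, List.filter_cons, not_lt.mp ha] using
        (CommEquiv.cons_append_singleton h2).append_right (w.filter (¬ · < i))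

/-- Two occurrences of `i` with no `i` or `i + 1` in between produce a factor `1 0 1`. -/
theorem IsFCWord.exists_commEquiv_of_gap {u w x y : List (Fin (n + 1))} {i : Fin (n + 1)}
    (hu : IsFCWord (affineC n) u) (h : u = x ++ i :: (w ++ i :: y))
    (hw : ∀ b ∈ w, (b : ℕ) ≠ i ∧ (b : ℕ) ≠ i + 1) (hi : (i : ℕ) < n) :
    0 < (i : ℕ) ∧ ∃ (p q : List (Fin (n + 1))) (o l : Fin (n + 1)), (o : ℕ) = 0 ∧ (l : ℕ) = 1 ∧
      CommEquiv (affineC n) u (p ++ l :: o :: l :: q) := by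
  subst h
  set w₁ := w.filter (· < i) with hw₁
  set w₂ := w.filter (¬ · < i) with hw₂
  have h1 : CommEquiv (affineC n) (x ++ i :: (w ++ i :: y)) (x ++ i :: (w₁ ++ w₂ ++ i :: y)) :=
    (((commEquiv_filter_append_filter hw).append_right (i :: y)).cons i).append_left x
  have h2 : ∀ b ∈ w₂, affineC n i b = 2 := by
    intro b hb
    simp only [hw₂, List.mem_filter, decide_eq_true_eq, Fin.lt_def] at hb
    have := hw b hb.1
    rw [affineC_eq_two_iff, Adj, ne_eq, Fin.ext_iff]
    omega
  have h3 : CommEquiv (affineC n) (x ++ i :: (w₁ ++ w₂ ++ i :: y))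
      (x ++ (i :: w₁ ++ [i]) ++ (w₂ ++ y)) := by
    have := ((CommEquiv.cons_append_singleton h2).symm.append_right y).append_left (x ++ i :: w₁)
    simpa using this
  have h4 := h1.trans h3
  obtain ⟨hi0, hz, hmem⟩ := IsFCWord.isZig_of_forall_lt (i := i) (w := w₁)
    ((hu.of_commEquiv h4).of_factor ⟨x, w₂ ++ y, rfl⟩) (by simp [hw₁]) hi
  refine ⟨hi0, ?_⟩
  obtain ⟨o, ho⟩ : ∃ o : Fin (n + 1), (o : ℕ) = 0 := ⟨0, rfl⟩
  have hoi : o ≠ i := by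
    rw [ne_eq, Fin.ext_iff]
    omega
  have ho' : o ∈ w₁ := by
    simpa [hoi] using hmem o (by rw [Fin.le_def]; omega)
  obtain ⟨s, t, hst⟩ := List.mem_iff_append.mp ho'
  obtain ⟨s', a, hs'⟩ : ∃ s' a, i :: s = s' ++ [a] := by
    rcases (i :: s).eq_nil_or_concat' with h | h
    · simp at h
    · exact h
  obtain ⟨b, t', ht'⟩ : ∃ b t', t ++ [i] = b :: t' := by
    rcases h : t ++ [i] with _ | ⟨b, t'⟩
    · simp at h
    · exact ⟨_, _, rfl⟩
  have e : i :: w₁ ++ [i] = s' ++ a :: o :: b :: t' := by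
    rw [hst]
    have : i :: (s ++ o :: t) ++ [i] = (i :: s) ++ o :: (t ++ [i]) := by simp
    rw [this, hs', ht']
    simp
  rw [e] at h4 hz
  have hao : Adj a o := hz.adj
  have hob : Adj o b := IsZig.adj (x := s' ++ [a]) (y := t') (by simpa using hz)
  obtain rfl : a = b := hao.symm.eq_of_isEnd hob (.inl ho)
  refine ⟨x ++ s', t' ++ (w₂ ++ y), o, a, ho, ?_, by simpa using h4⟩
  unfold Adj at hob
  omega

theorem IsFCWord.isZig_append {z w : List (Fin (n + 1))} (hz : IsZig z) (hmem : ∀ y, y ∈ z.tail)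
    (h : IsFCWord (affineC n) (z ++ w)) : IsZig (z ++ w) := by
  have hmem' : ∀ w' y, y ∈ (z ++ w').tail := by
    intro w' y
    rcases z with _ | ⟨a, z⟩
    · simp at hmem
    · simpa using .inl (hmem y)
  induction w using List.reverseRecOn with
  | nil => simpa using hz
  | append_singleton w a ih =>
    have h1 := ih (h.of_factor ⟨[], [a], by simp⟩)
    rw [← List.append_assoc] at h ⊢
    exact IsFCWord.isZig_append_singleton h1 h (List.mem_of_mem_tail (hmem' w a))
      fun _ => hmem' w a

/-- A zigzag that is long enough propagates through any fully commutative word. -/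
theorem IsFCWord.isZig_append_append {x z y : List (Fin (n + 1))} (hz : IsZig z)
    (hmem : ∀ y, y ∈ z.tail) (hmem' : ∀ y, y ∈ z.reverse.tail)
    (h : IsFCWord (affineC n) (x ++ z ++ y)) : IsZig (x ++ z ++ y) := by
  have h1 : IsZig (x ++ z) := by
    have := IsFCWord.isZig_append hz.reverse hmem' (w := x.reverse) (by
      simpa using (h.of_factor (u := x ++ z) ⟨[], y, by simp⟩).reverse)
    simpa using this.reverse
  refine IsFCWord.isZig_append h1 (fun a => ?_) h
  rcases x with _ | ⟨b, x⟩
  · simpa using hmem a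
  · simpa using .inr (List.mem_of_mem_tail (hmem a))

theorem IsFCWord.isZig_of_two_le_count (hn : 2 ≤ n) {p q : List (Fin (n + 1))} {o l : Fin (n + 1)}
    (ho : (o : ℕ) = 0) (hl : (l : ℕ) = 1) (h : IsFCWord (affineC n) (p ++ l :: o :: l :: q))
    (hc : 2 ≤ (p ++ l :: o :: l :: q).count o) : IsZig (p ++ l :: o :: l :: q) := by
  have hol : Adj o l := .inl (by omega)
  have hne := hol.ne
  wlog hoq : o ∈ q generalizing p q
  · have hop : o ∈ p := by
      by_contra hop
      simp [List.count_eq_zero_of_not_mem hop, List.count_eq_zero_of_not_mem hoq, hne.symm] at hc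
    have := this (p := q.reverse) (q := p.reverse) (by simpa using h.reverse) (by
      rw [← List.count_reverse]; simpa using hc) (by simpa using hop)
    simpa using this.reverse
  obtain ⟨e, f, rfl, hoe⟩ := List.eq_append_cons_of_mem hoq
  have hle : l ∈ e := by
    by_contra hle
    have h1 : ∀ b ∈ e, affineC n o b = 2 := by
      intro b hb
      have h2 : b ≠ o := fun h => hoe (h ▸ hb)
      have h3 : b ≠ l := fun h => hle (h ▸ hb)
      rw [ne_eq, Fin.ext_iff] at h2 h3
      rw [affineC_eq_two_iff, ne_eq, Fin.ext_iff, Adj]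
      omega
    have h2 := ((CommEquiv.cons_append_singleton h1).symm.append_right f).append_left
      (p ++ [l, o, l])
    have h3 : IsFCWord (affineC n) (p ++ l :: o :: l :: o :: (e ++ f)) :=
      h.of_commEquiv (by simpa using h2)
    exact IsFCWord.not_alternating_four hol.symm h3
  obtain ⟨e₁, e₂, rfl, hle₁⟩ := List.eq_append_cons_of_mem hle
  have hoe₁ : o ∉ e₁ := fun h => hoe (by simp [h])
  have hpeak := IsFCWord.isZig_of_forall_lt (i := l.rev) (w := e₁.map Fin.rev)
    (by
      have h1 : IsFCWord (affineC n) (l :: e₁ ++ [l]) :=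
        h.of_factor ⟨p ++ [l, o], e₂ ++ o :: f, by simp⟩
      simpa using h1.map_rev)
    (by
      intro b hb
      obtain ⟨b, hb', rfl⟩ := List.mem_map.mp hb
      have h2 : b ≠ o := fun h => hoe₁ (h ▸ hb')
      have h3 : b ≠ l := fun h => hle₁ (h ▸ hb')
      rw [ne_eq, Fin.ext_iff] at h2 h3
      rw [Fin.rev_lt_rev, Fin.lt_def]
      omega)
    (by rw [Fin.val_rev]; omega)
  obtain ⟨-, hz, hmem⟩ := hpeak
  have hz' : IsZig (l :: e₁ ++ [l]) := IsZig.of_map_rev (by simpa using hz)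
  have hmem' : ∀ y, y ≠ o → y ∈ l :: e₁ := by
    intro y hy
    have h1 := hmem y.rev (by
      rw [ne_eq, Fin.ext_iff] at hy
      rw [Fin.rev_le_rev, Fin.le_def]
      omega)
    have h2 : y ∈ l :: e₁ ++ [l] := by
      rw [← List.mem_map_of_injective Fin.rev_injective]
      simpa using h1
    simp at h2 ⊢
    tauto
  have hz₂ : IsZig (l :: o :: (l :: e₁ ++ [l])) := by
    refine IsZig.cons ?_ hol.symm fun _ => .inl ho
    rcases e₁ with _ | ⟨c, e₁⟩
    · exact IsZig.cons hz' hol fun h => (hne h).elim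
    · exact IsZig.cons hz' hol fun h => (hoe₁ (by simp [h])).elim
  have := IsFCWord.isZig_append_append (x := p) (y := e₂ ++ o :: f) hz₂ (fun y => ?_) (fun y => ?_)
    (by simpa using h)
  · simpa using this
  · by_cases hy : y = o
    · simp [hy]
    · have := hmem' y hy
      simp at this ⊢
      tauto
  · by_cases hy : y = o
    · simp [hy]
    · have := hmem' y hy
      simp at this ⊢
      tauto

theorem IsFCWord.count_le_one_of_gap (hn : 2 ≤ n) {u w x y : List (Fin (n + 1))} {i : Fin (n + 1)}
    (hu : IsFCWord (affineC n) u) (hz : ¬ IsZig u) (h : u = x ++ i :: (w ++ i :: y))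
    (hw : ∀ b ∈ w, (b : ℕ) ≠ i ∧ (b : ℕ) ≠ i + 1) (hi : (i : ℕ) < n) : u.count 0 ≤ 1 := by
  obtain ⟨-, p, q, o, l, ho, hl, hc⟩ := hu.exists_commEquiv_of_gap h hw hi
  obtain rfl : o = 0 := Fin.ext ho
  by_contra hcount
  have := IsFCWord.isZig_of_two_le_count hn ho hl (hu.of_commEquiv hc) (by
    rw [← hc.perm.count_eq]
    omega)
  exact hz ((this.eq_of_commEquiv hc.symm) ▸ this)

theorem exists_gap_of_count_add_two_le {α : Type*} [DecidableEq α] {a b : α} (hab : a ≠ b)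
    {u : List α} (h : u.count b + 2 ≤ u.count a) :
    ∃ x w y, u = x ++ a :: (w ++ a :: y) ∧ ∀ c ∈ w, c ≠ a ∧ c ≠ b := by
  induction hk : u.length using Nat.strong_induction_on generalizing u with
  | _ k ih =>
    subst hk
    rcases u with _ | ⟨c, u⟩
    · simp at h
    by_cases hca : c = a
    · subst hca
      have hmem : c ∈ u := by
        by_contra hc
        simp [List.count_eq_zero_of_not_mem hc] at h
      obtain ⟨w, y, rfl, hw⟩ := List.eq_append_cons_of_mem hmem
      by_cases hb : b ∈ w
      · have hb' : 1 ≤ w.count b := List.one_le_count_iff.mpr hb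
        have := ih (c :: y).length (by simp) (u := c :: y) (by
          simp [List.count_eq_zero_of_not_mem hw, hab] at h ⊢
          omega) rfl
        obtain ⟨x', w', y', he, hw'⟩ := this
        exact ⟨c :: w ++ x', w', y', by simp [he], hw'⟩
      · exact ⟨[], w, y, rfl, fun d hd => ⟨fun h => hw (h ▸ hd), fun h => hb (h ▸ hd)⟩⟩
    · obtain ⟨x', w', y', he, hw'⟩ := ih u.length (by simp) (u := u) (by
        simp [List.count_cons, hca] at h ⊢
        omega) rfl
      exact ⟨c :: x', w', y', by simp [he], hw'⟩

theorem IsFCWord.count_le_of_count_zero {u : List (Fin (n + 1))} {i j : Fin (n + 1)}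
    (hij : (i : ℕ) + 1 = j) (hu : IsFCWord (affineC n) u) (h0 : u.count 0 = 0) :
    u.count i ≤ u.count j + 1 := by
  by_contra hc
  have hne : i ≠ j := by
    rw [ne_eq, Fin.ext_iff]
    omega
  obtain ⟨x, w, y, he, hw⟩ := exists_gap_of_count_add_two_le hne (u := u) (by omega)
  obtain ⟨-, p, q, o, l, ho, hl, hc⟩ := hu.exists_commEquiv_of_gap he
    (fun b hb => by
      have := hw b hb
      rw [ne_eq, ne_eq, Fin.ext_iff, Fin.ext_iff] at this
      omega) (by omega)
  obtain rfl : o = 0 := Fin.ext ho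
  rw [hc.perm.count_eq] at h0
  rw [List.count_eq_zero] at h0
  simp at h0

theorem IsFCWord.count_le (hn : 2 ≤ n) {u : List (Fin (n + 1))} {i j : Fin (n + 1)}
    (hij : (i : ℕ) + 1 = j) (hu : IsFCWord (affineC n) u) (hz : ¬ IsZig u) :
    u.count i ≤ u.count j + 2 := by
  obtain h0 | h0 | h0 : u.count 0 = 0 ∨ u.count 0 = 1 ∨ 2 ≤ u.count 0 := by omega
  · have := hu.count_le_of_count_zero hij h0
    omega
  · by_cases hi : i = 0
    · subst hi
      omega
    have hmem : (0 : Fin (n + 1)) ∈ u := by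
      rw [← List.one_le_count_iff]
      omega
    obtain ⟨s, t, rfl, hs⟩ := List.eq_append_cons_of_mem hmem
    have hs0 := List.count_eq_zero_of_not_mem hs
    have ht0 : t.count 0 = 0 := by
      simp [hs0] at h0
      simpa using h0
    have h1 := (hu.of_factor (u := s) ⟨[], 0 :: t, by simp⟩).count_le_of_count_zero hij hs0
    have h2 := (hu.of_factor (u := t) ⟨s ++ [0], [], by simp⟩).count_le_of_count_zero hij ht0
    have h3 : t.count j ≤ (0 :: t).count j := List.count_le_count_cons
    have h4 : (0 :: t).count i = t.count i := List.count_cons_of_ne (Ne.symm hi)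
    rw [List.count_append, List.count_append]
    omega
  · by_contra hc
    have hne : i ≠ j := by
      rw [ne_eq, Fin.ext_iff]
      omega
    obtain ⟨x, w, y, he, hw⟩ := exists_gap_of_count_add_two_le hne (u := u) (by omega)
    have := hu.count_le_one_of_gap hn hz he
      (fun b hb => by
        have := hw b hb
        rw [ne_eq, ne_eq, Fin.ext_iff, Fin.ext_iff] at this
        omega) (by omega)
    omega

theorem IsFCWord.count_le_of_adj (hn : 2 ≤ n) {u : List (Fin (n + 1))} {i j : Fin (n + 1)}
    (hij : Adj i j) (hu : IsFCWord (affineC n) u) (hz : ¬ IsZig u) :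
    u.count i ≤ u.count j + 2 := by
  rcases hij with hij | hij
  · exact hu.count_le hn hij hz
  · have := hu.map_rev.count_le hn (i := i.rev) (j := j.rev)
      (by rw [Fin.val_rev, Fin.val_rev]; omega) fun h => hz h.of_map_rev
    rwa [List.count_map_of_injective _ _ Fin.rev_injective,
      List.count_map_of_injective _ _ Fin.rev_injective] at this

section AlternatingLists

variable {α : Type*}

theorem List.Palindrome.exists_factor {l : List α} (h : l.Palindrome) :
    (Even l.length → l ≠ [] → ∃ a, [a, a] <:+: l) ∧
      (Odd l.length → l.length ≠ 1 → ∃ a b, [a, b, a] <:+: l) := by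
  induction h with
  | nil => simp
  | singleton x => simp
  | @cons_concat x l _ ih =>
    have hl : l <:+: x :: (l ++ [x]) := ⟨[x], [x], by simp⟩
    have hlen : (x :: (l ++ [x])).length = l.length + 2 := by simp
    rw [hlen]
    refine ⟨fun he _ => ?_, fun ho _ => ?_⟩
    · rcases eq_or_ne l [] with rfl | hne
      · exact ⟨x, [], [], rfl⟩
      · obtain ⟨a, ha⟩ := ih.1 (by simpa [parity_simps] using he) hne
        exact ⟨a, ha.trans hl⟩
    · have ho' : Odd l.length := by simpa [parity_simps] using ho
      by_cases h1 : l.length = 1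
      · obtain ⟨b, rfl⟩ := List.length_eq_one_iff.mp h1
        exact ⟨x, b, [], [], rfl⟩
      · obtain ⟨a, b, ha⟩ := ih.2 ho' h1
        exact ⟨a, b, ha.trans hl⟩

theorem List.IsChain.not_factor {l : List α} (h : l.IsChain (· ≠ ·)) (a : α) : ¬ [a, a] <:+: l := by
  rintro ⟨x, y, rfl⟩
  simp [List.isChain_append] at h

theorem odd_length_of_isChain_ne {l : List α} (h : l.IsChain (· ≠ ·)) (hl : l.reverse = l)
    (hne : l ≠ []) : Odd l.length := by
  by_contra ho
  obtain ⟨a, ha⟩ := (List.Palindrome.of_reverse_eq hl).exists_factor.1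
    (Nat.not_odd_iff_even.mp ho) hne
  exact h.not_factor a ha

theorem eq_of_isChain_ne_of_cons {a b c : α} {l l' : List α} (h : (c :: l).IsChain (· ≠ ·))
    (h' : (c :: l').IsChain (· ≠ ·)) (hl : ∀ x ∈ c :: l, x = a ∨ x = b)
    (hl' : ∀ x ∈ c :: l', x = a ∨ x = b) (hlen : l.length = l'.length) : l = l' := by
  induction l generalizing c l' with
  | nil => simpa [eq_comm] using hlen
  | cons d l ih =>
    rcases l' with _ | ⟨d', l'⟩
    · simp at hlen
    have h1 := hl c (by simp)
    have h2 := hl d (by simp)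
    have h3 := hl' d' (by simp)
    rw [List.isChain_cons_cons] at h h'
    have h4 := h.1
    have h5 := h'.1
    obtain rfl : d = d' := by
      rcases h1 with rfl | rfl <;> rcases h2 with rfl | rfl <;> rcases h3 with rfl | rfl <;>
      first | rfl | exact (h4 rfl).elim | exact (h5 rfl).elim
    rw [ih h.2 h'.2 (fun x hx => hl x (by simp [hx])) (fun x hx => hl' x (by simp [hx]))
      (by simpa using hlen)]

theorem exists_eq_append_of_infix_filter {p : α → Bool} {a b : α} {l : List α}
    (h : [a, b] <:+: l.filter p) :
    ∃ x w y, l = x ++ a :: (w ++ b :: y) ∧ ∀ c ∈ w, ¬ p c := by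
  obtain ⟨s, t, hst⟩ := h
  have h1 : l.filter p = s ++ a :: (b :: t) := by simp [← hst]
  obtain ⟨l₁, l₂, rfl, -, h2⟩ := List.filter_eq_append_iff.mp h1
  obtain ⟨x, l₃, rfl, -, -, h3⟩ := List.filter_eq_cons_iff.mp h2
  obtain ⟨w, y, rfl, hw, -, -⟩ := List.filter_eq_cons_iff.mp h3
  exact ⟨l₁ ++ x, w, y, by simp, hw⟩

theorem infix_filter_of_eq_append {p : α → Bool} {a b : α} {l x w y : List α}
    (h : l = x ++ a :: (w ++ b :: y)) (ha : p a) (hb : p b) (hw : ∀ c ∈ w, ¬ p c) :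
    [a, b] <:+: l.filter p := by
  have h1 : w.filter p = [] := List.filter_eq_nil_iff.mpr hw
  exact ⟨x.filter p, y.filter p, by simp [h, List.filter_append, h1, ha, hb]⟩

variable [DecidableEq α]

theorem count_of_isChain_ne {a b : α} (hab : a ≠ b) {l : List α} (h : (a :: l).IsChain (· ≠ ·))
    (hl : ∀ x ∈ a :: l, x = a ∨ x = b) :
    (a :: l).count a = (a :: l).count b ∨ (a :: l).count a = (a :: l).count b + 1 := by
  induction l generalizing a b with
  | nil => simp [hab]
  | cons d l ih =>
    rw [List.isChain_cons_cons] at h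
    obtain rfl : d = b := (hl d (by simp)).resolve_left h.1.symm
    have := ih hab.symm h.2 (fun x hx => (hl x (by simp [hx])).symm)
    have e1 : (a :: d :: l).count a = (d :: l).count a + 1 := by simp
    have e2 : (a :: d :: l).count d = (d :: l).count d := List.count_cons_of_ne hab
    omega

theorem length_eq_count_add_count {a b : α} (hab : a ≠ b) {l : List α}
    (hl : ∀ x ∈ l, x = a ∨ x = b) : l.length = l.count a + l.count b := by
  induction l with
  | nil => rfl
  | cons d l ih =>
    have := ih fun x hx => hl x (by simp [hx])
    rcases hl d (by simp) with rfl | rfl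
    · simp [hab]; omega
    · simp [hab.symm]; omega

/-- Alternating palindromes in two letters are determined by the number of times each of the
letters occurs. -/
theorem eq_of_isChain_ne_of_reverse_eq {a b : α} (hab : a ≠ b) {l l' : List α}
    (h : l.IsChain (· ≠ ·)) (h' : l'.IsChain (· ≠ ·)) (hl : ∀ x ∈ l, x = a ∨ x = b)
    (hl' : ∀ x ∈ l', x = a ∨ x = b) (hr : l.reverse = l) (ha : l.count a = l'.count a)
    (hb : l.count b = l'.count b) : l = l' := by
  have hlen : l.length = l'.length := by
    rw [length_eq_count_add_count hab hl, length_eq_count_add_count hab hl', ha, hb]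
  rcases l with _ | ⟨c, l⟩
  · simpa [eq_comm] using hlen
  rcases l' with _ | ⟨c', l'⟩
  · simp at hlen
  have hodd := odd_length_of_isChain_ne h hr (by simp)
  rw [length_eq_count_add_count hab hl, Nat.odd_iff] at hodd
  obtain rfl : c = c' := by
    rcases hl c (by simp) with rfl | rfl <;> rcases hl' c' (by simp) with rfl | rfl
    · rfl
    · have h1 := count_of_isChain_ne hab h hl
      have h2 := count_of_isChain_ne hab.symm h' fun x hx => (hl' x hx).symm
      omega
    · have h1 := count_of_isChain_ne hab h' hl'
      have h2 := count_of_isChain_ne hab.symm h fun x hx => (hl x hx).symm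
      omega
    · rfl
  rw [eq_of_isChain_ne_of_cons h h' hl hl' (by simpa using hlen)]

/-- Two words with the same projections onto the pairs of noncommuting letters are
commutation-equivalent. -/
theorem CommEquiv.of_filter_eq {M : CoxeterMatrix α} {u v : List α}
    (h : ∀ a b, M a b ≠ 2 →
      u.filter (fun c => c = a ∨ c = b) = v.filter (fun c => c = a ∨ c = b)) :
    CommEquiv M u v := by
  induction u generalizing v with
  | nil =>
    obtain rfl : v = [] := by
      refine List.eq_nil_iff_forall_not_mem.mpr fun b hb => ?_
      have := h b b (by simp)
      rw [List.filter_nil, eq_comm, List.filter_eq_nil_iff] at this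
      simpa using this b hb
    exact .refl _
  | cons a u ih =>
    have hav : a ∈ v := by
      have h1 := h a a (by simp)
      have : a ∈ v.filter (fun c => c = a ∨ c = a) := by rw [← h1]; simp
      exact (List.mem_filter.mp this).1
    obtain ⟨x, y, rfl, hx⟩ := List.eq_append_cons_of_mem hav
    have hcomm : ∀ b ∈ x, M a b = 2 := by
      intro b hb
      by_contra hne
      have h1 := h a b hne
      have h2 : x.filter (fun c => c = a ∨ c = b) ≠ [] := by
        rw [ne_eq, List.filter_eq_nil_iff]
        intro h3
        simpa using h3 b hb
      obtain ⟨c, l, hc⟩ := List.exists_cons_of_ne_nil h2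
      have hcx : c ∈ x := List.mem_of_mem_filter (p := fun c => decide (c = a ∨ c = b))
        (by rw [hc]; simp)
      rw [List.filter_append, hc] at h1
      simp at h1
      exact hx (h1.1 ▸ hcx)
    have h1 : CommEquiv M (a :: (x ++ y)) (x ++ a :: y) := by
      simpa using (CommEquiv.cons_append_singleton hcomm).append_right y
    refine (CommEquiv.cons a (ih fun b c hbc => ?_)).trans h1
    have h2 := h b c hbc
    have h3 : (a :: (x ++ y)).filter (fun d => d = b ∨ d = c) =
        (x ++ a :: y).filter (fun d => d = b ∨ d = c) := by
      refine h1.filter_eq fun p q hpq hp hq => ?_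
      simp only [decide_eq_true_eq] at hp hq
      have h4 := M.diagonal b
      have h5 := M.diagonal c
      have h6 := M.symmetric b c
      rcases hp with rfl | rfl <;> rcases hq with rfl | rfl <;> omega
    rw [← h3] at h2
    by_cases ha : a = b ∨ a = c
    · simpa [List.filter_cons, ha] using h2
    · simpa [List.filter_cons, ha] using h2

end AlternatingLists

/-- Words in which the occurrences of any two adjacent letters alternate. -/
def IsAltWord (u : List (Fin (n + 1))) : Prop :=
  ∀ i j, Adj i j → (u.filter (fun a => a = i ∨ a = j)).IsChain (· ≠ ·)

theorem exists_adj (hn : 2 ≤ n) (a : Fin (n + 1)) : ∃ b, Adj a b := by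
  by_cases h : (a : ℕ) = n
  · exact ⟨⟨n - 1, by omega⟩, .inr (by simp; omega)⟩
  · exact ⟨⟨a + 1, by omega⟩, .inl rfl⟩

theorem exists_adj_ne {a b : Fin (n + 1)} (hab : Adj a b) (ha : ¬ IsEnd a) :
    ∃ c, Adj a c ∧ c ≠ b := by
  unfold IsEnd at ha
  rcases hab with h | h
  · exact ⟨⟨a - 1, by omega⟩, .inr (by simp; omega), by rw [ne_eq, Fin.ext_iff]; simp; omega⟩
  · exact ⟨⟨a + 1, by omega⟩, .inl rfl, by rw [ne_eq, Fin.ext_iff]; simp; omega⟩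

theorem decide_adj_of_commute {i j : Fin (n + 1)} (hij : Adj i j) (a b : Fin (n + 1))
    (hab : affineC n a b = 2) (ha : decide (a = i ∨ a = j)) : ¬ decide (b = i ∨ b = j) := by
  obtain ⟨h1, h2⟩ := affineC_eq_two_iff.mp hab
  simp only [decide_eq_true_eq] at ha ⊢
  rintro (rfl | rfl) <;> rcases ha with rfl | rfl
  exacts [h1 rfl, h2 hij.symm, h2 hij, h1 rfl]

namespace IsAltWord

theorem of_commEquiv {u v : List (Fin (n + 1))} (hu : IsAltWord u)
    (h : CommEquiv (affineC n) u v) : IsAltWord v := by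
  intro i j hij
  rw [← h.filter_eq (decide_adj_of_commute hij)]
  exact hu i j hij

theorem not_gap {u x w y : List (Fin (n + 1))} {a b : Fin (n + 1)} (hu : IsAltWord u)
    (hab : Adj a b) (h : u = x ++ a :: (w ++ a :: y)) : ∃ c ∈ w, c = a ∨ c = b := by
  by_contra hc
  push Not at hc
  refine (hu a b hab).not_factor a (infix_filter_of_eq_append h (by simp) (by simp) ?_)
  simpa using hc

theorem isEnd {u : List (Fin (n + 1))} {a b : Fin (n + 1)} (hu : IsAltWord u) (hab : Adj a b)
    (h : [a, b, a] <:+: u) : IsEnd a := by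
  by_contra ha
  obtain ⟨x, y, rfl⟩ := h
  obtain ⟨c, hc, hcb⟩ := exists_adj_ne hab ha
  obtain ⟨d, hd, hd'⟩ := hu.not_gap hc (x := x) (w := [b]) (y := y) (by simp)
  obtain rfl := List.mem_singleton.mp hd
  rcases hd' with rfl | rfl
  exacts [hab.ne rfl, hcb rfl]

theorem isFCWord (hn : 2 ≤ n) {u : List (Fin (n + 1))} (hu : IsAltWord u) :
    IsFCWord (affineC n) u := by
  intro v hv
  replace hu := hu.of_commEquiv hv
  refine ⟨fun s hs => ?_, fun s t hst hs => ?_⟩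
  · obtain ⟨t, hst⟩ := exists_adj hn s
    obtain ⟨x, y, rfl⟩ := hs
    obtain ⟨d, hd, -⟩ := hu.not_gap hst (x := x) (w := []) (y := y) (by simp)
    simp at hd
  · have hne : s ≠ t := by
      rintro rfl
      rw [(affineC n).diagonal] at hst
      omega
    have hadj : Adj s t := by
      by_contra h
      rw [affineC_eq_two_iff.mpr ⟨hne, h⟩] at hst
      omega
    rw [braidWord] at hs
    rcases affineC_of_adj hadj with h | h <;> rw [h.1] at hs
    · obtain ⟨x, y, rfl⟩ := hs
      have h1 := hu.isEnd hadj ⟨x, t :: y, by simp [alternatingWord]⟩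
      have h2 := hu.isEnd hadj.symm ⟨x ++ [s], y, by simp [alternatingWord]⟩
      unfold IsEnd at h1 h2
      unfold Adj at hadj
      omega
    · exact h.2.2 (hu.isEnd hadj.symm (by simpa [alternatingWord] using hs))

theorem count_le {u : List (Fin (n + 1))} {i j : Fin (n + 1)} (hu : IsAltWord u) (hij : Adj i j) :
    u.count i ≤ u.count j + 1 := by
  by_contra hc
  obtain ⟨x, w, y, he, hw⟩ := exists_gap_of_count_add_two_le hij.ne (u := u) (by omega)
  obtain ⟨c, hc, hc'⟩ := hu.not_gap hij he
  rcases hc' with h | h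
  exacts [(hw c hc).1 h, (hw c hc).2 h]

theorem filter_reverse {u : List (Fin (n + 1))} {i j : Fin (n + 1)}
    (hu' : CommEquiv (affineC n) u u.reverse) (hij : Adj i j) :
    (u.filter (fun a => a = i ∨ a = j)).reverse = u.filter (fun a => a = i ∨ a = j) := by
  rw [← List.filter_reverse]
  exact (hu'.filter_eq (decide_adj_of_commute hij)).symm

theorem mem_or {u : List (Fin (n + 1))} {i j : Fin (n + 1)} :
    ∀ x ∈ u.filter (fun a => a = i ∨ a = j), x = i ∨ x = j := by
  intro x hx
  simpa using (List.mem_filter.mp hx).2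

theorem count_ne {u : List (Fin (n + 1))} {i j : Fin (n + 1)} (hu : IsAltWord u)
    (hu' : CommEquiv (affineC n) u u.reverse) (hij : Adj i j) (hi : u.count i ≠ 0) :
    u.count i ≠ u.count j := by
  have h1 := odd_length_of_isChain_ne (hu i j hij) (filter_reverse hu' hij) (by
    rw [ne_eq, List.filter_eq_nil_iff]
    intro h
    simpa using h i (by rwa [← List.count_pos_iff, Nat.pos_iff_ne_zero]))
  rw [length_eq_count_add_count hij.ne mem_or, List.count_filter (by simp),
    List.count_filter (by simp), Nat.odd_iff] at h1
  omega

theorem commEquiv {u v : List (Fin (n + 1))} (hu : IsAltWord u) (hv : IsAltWord v)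
    (hu' : CommEquiv (affineC n) u u.reverse) (h : ∀ i, u.count i = v.count i) :
    CommEquiv (affineC n) u v := by
  have key : ∀ a b, Adj a b →
      u.filter (fun c => c = a ∨ c = b) = v.filter (fun c => c = a ∨ c = b) := by
    intro a b hab
    refine eq_of_isChain_ne_of_reverse_eq hab.ne (hu a b hab) (hv a b hab) mem_or mem_or
      (filter_reverse hu' hab) ?_ ?_ <;>
    rw [List.count_filter (by simp), List.count_filter (by simp), h]
  refine CommEquiv.of_filter_eq fun a b hab => ?_
  by_cases hab' : a = b
  · subst hab'
    simp only [or_self, List.filter_eq, h]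
  · exact key a b (by
      by_contra h
      exact hab (affineC_eq_two_iff.mpr ⟨hab', h⟩))

end IsAltWord

theorem IsFCWord.exists_isEnd_count_le_one (hn : 2 ≤ n) {u : List (Fin (n + 1))}
    (hu : IsFCWord (affineC n) u) (hz : ¬ IsZig u) (ha : ¬ IsAltWord u) :
    u.count 0 ≤ 1 ∨ u.count (Fin.last n) ≤ 1 := by
  have hgap : ∃ (a b : Fin (n + 1)) (x w y : List (Fin (n + 1))), Adj a b ∧
      u = x ++ a :: (w ++ a :: y) ∧ ∀ c ∈ w, c ≠ a ∧ c ≠ b := by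
    by_contra hc
    push Not at hc
    refine ha fun i j hij => ?_
    rw [List.isChain_iff_forall_rel_of_append_cons_cons]
    rintro p q s t hst rfl
    have hpq : [p, p] <:+: u.filter (fun a => a = i ∨ a = j) := ⟨s, t, by rw [hst]; simp⟩
    obtain ⟨x, w, y, he, hw⟩ := exists_eq_append_of_infix_filter hpq
    simp only [decide_eq_true_eq, not_or] at hw
    have hp : p ∈ u.filter (fun a => a = i ∨ a = j) := hpq.subset (by simp)
    rcases IsAltWord.mem_or p hp with rfl | rfl
    · obtain ⟨c, hc, hc'⟩ := hc p j x w y hij he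
      exact (hw c hc).2 (hc' (hw c hc).1)
    · obtain ⟨c, hc, hc'⟩ := hc p i x w y hij.symm he
      exact (hw c hc).1 (hc' (hw c hc).2)
  obtain ⟨a, b, x, w, y, hab, he, hw⟩ := hgap
  rcases hab with hab | hab
  · refine .inl (hu.count_le_one_of_gap hn hz he (fun c hc => ?_) (by omega))
    have := hw c hc
    rw [ne_eq, ne_eq, Fin.ext_iff, Fin.ext_iff] at this
    omega
  · have h1 := hu.map_rev.count_le_one_of_gap hn (fun h => hz h.of_map_rev)
      (i := a.rev) (x := x.map Fin.rev) (w := w.map Fin.rev) (y := y.map Fin.rev) (by simp [he])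
      (fun c hc => by
        obtain ⟨c, hc', rfl⟩ := List.mem_map.mp hc
        have := hw c hc'
        rw [ne_eq, ne_eq, Fin.ext_iff, Fin.ext_iff] at this
        rw [Fin.val_rev, Fin.val_rev]
        omega) (by rw [Fin.val_rev]; omega)
    right
    rwa [← Fin.rev_last, List.count_map_of_injective _ _ Fin.rev_injective] at h1

/-- The letters `i` with `h < c i` such that `c i` and `h` have different parities. -/
def altLayer (c : Fin (n + 1) → ℕ) (h : ℕ) : List (Fin (n + 1)) :=
  (List.finRange (n + 1)).filter fun i => h < c i ∧ c i % 2 ≠ h % 2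

/-- A word in which `i` occurs `c i` times if `k` is large enough, built in a symmetric way around
the middle layer. -/
def altWord (c : Fin (n + 1) → ℕ) : ℕ → List (Fin (n + 1))
  | 0 => altLayer c 0
  | k + 1 => altLayer c (k + 1) ++ altWord c k ++ altLayer c (k + 1)

theorem filter_eq_altLayer (c : Fin (n + 1) → ℕ) (h : ℕ) (i : Fin (n + 1)) :
    (altLayer c h).filter (fun a => a = i) = if h < c i ∧ c i % 2 ≠ h % 2 then [i] else [] := by
  have h1 : (List.finRange (n + 1)).filter (fun a => a = i) = [i] := by
    rw [List.filter_eq, List.count_eq_one_of_mem (List.nodup_finRange _) (List.mem_finRange i)]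
    rfl
  rw [altLayer, List.filter_comm, h1]
  simp [List.filter_cons]

theorem count_altLayer (c : Fin (n + 1) → ℕ) (h : ℕ) (i : Fin (n + 1)) :
    (altLayer c h).count i = if h < c i ∧ c i % 2 ≠ h % 2 then 1 else 0 := by
  have h1 := filter_eq_altLayer c h i
  rw [List.filter_eq] at h1
  have := congrArg List.length h1
  rw [List.length_replicate] at this
  rw [this]
  split_ifs <;> rfl

theorem count_altWord (c : Fin (n + 1) → ℕ) (k : ℕ) (i : Fin (n + 1)) :
    (altWord c k).count i =
      if c i ≤ k + 1 then c i else if (k + 1) % 2 = c i % 2 then k + 1 else k := by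
  induction k with
  | zero =>
    rw [altWord, count_altLayer]
    split_ifs <;> omega
  | succ k ih =>
    rw [altWord, List.count_append, List.count_append, count_altLayer, ih]
    split_ifs <;> omega

theorem filter_altLayer {c : Fin (n + 1) → ℕ} {i j : Fin (n + 1)} (hij : c j = c i + 1) (h : ℕ) :
    (altLayer c h).filter (fun a => a = i ∨ a = j) =
      if h < c j then [if c i % 2 = h % 2 then j else i] else [] := by
  have key : ∀ x y : Fin (n + 1), c y % 2 = h % 2 →
      (altLayer c h).filter (fun a => a = x ∨ a = y) = (altLayer c h).filter (fun a => a = x) := by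
    intro x y hy
    refine List.filter_congr fun a ha => ?_
    have h1 := (List.mem_filter.mp ha).2
    simp only [decide_eq_true_eq] at h1
    have h2 : a ≠ y := by
      rintro rfl
      exact h1.2 hy
    simp [h2]
  by_cases hp : c i % 2 = h % 2
  · simp only [or_comm (b := _ = j)]
    rw [key j i hp, filter_eq_altLayer]
    by_cases hlt : h < c j
    · rw [if_pos ⟨hlt, by omega⟩, if_pos hlt, if_pos hp]
    · rw [if_neg (fun h => hlt h.1), if_neg hlt]
  · rw [key i j (by omega), filter_eq_altLayer]
    by_cases hlt : h < c j
    · rw [if_pos ⟨by omega, hp⟩, if_pos hlt, if_neg hp]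
    · rw [if_neg (fun h => by omega), if_neg hlt]

theorem filter_altWord {c : Fin (n + 1) → ℕ} {i j : Fin (n + 1)} (hne : i ≠ j)
    (hij : c j = c i + 1) (k : ℕ) :
    ((altWord c k).filter (fun a => a = i ∨ a = j)).IsChain (· ≠ ·) ∧
      ((altWord c k).filter (fun a => a = i ∨ a = j)).reverse =
        (altWord c k).filter (fun a => a = i ∨ a = j) ∧
      (k < c j → ((altWord c k).filter (fun a => a = i ∨ a = j)).head? =
        some (if c i % 2 = k % 2 then j else i)) := by
  induction k with
  | zero =>
    rw [altWord, filter_altLayer hij, if_pos (by omega)]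
    simp
  | succ k ih =>
    rw [altWord, List.filter_append, List.filter_append, filter_altLayer hij]
    set e := (altWord c k).filter (fun a => a = i ∨ a = j)
    obtain ⟨h1, h2, h3⟩ := ih
    by_cases hk : k + 1 < c j
    · rw [if_pos hk]
      have h4 := h3 (by omega)
      have h5 : e.getLast? = some (if c i % 2 = k % 2 then j else i) := by
        rw [← h2, List.getLast?_reverse, h4]
      have h6 : (if c i % 2 = k % 2 then j else i) ≠ (if c i % 2 = (k + 1) % 2 then j else i) := by
        split_ifs
        · omega
        · exact hne.symm
        · exact hne
        · omega
      generalize (if c i % 2 = (k + 1) % 2 then j else i) = x at *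
      refine ⟨?_, by simp [h2], by simp⟩
      rw [List.append_assoc, List.isChain_append, List.isChain_append]
      simp [h1, h4, h5, h6, h6.symm, List.head?_append]
    · rw [if_neg hk]
      simpa [h2] using ⟨h1, fun h => (hk h).elim⟩

theorem length_eq_sum_count (u : List (Fin (n + 1))) : u.length = ∑ i, u.count i := by
  have := Multiset.sum_count_eq_card (s := Finset.univ) (m := (u : Multiset (Fin (n + 1))))
    fun a _ => Finset.mem_univ a
  simpa using this.symm

theorem filter_altWord_of_adj {c : Fin (n + 1) → ℕ}
    (hc : ∀ i j, Adj i j → c j = c i + 1 ∨ c i = c j + 1)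
    {i j : Fin (n + 1)} (hij : Adj i j) (k : ℕ) :
    ((altWord c k).filter (fun a => a = i ∨ a = j)).IsChain (· ≠ ·) ∧
      ((altWord c k).filter (fun a => a = i ∨ a = j)).reverse =
        (altWord c k).filter (fun a => a = i ∨ a = j) := by
  rcases hc i j hij with h | h
  · have := filter_altWord hij.ne h k
    exact ⟨this.1, this.2.1⟩
  · have := filter_altWord hij.ne.symm h k
    simp only [or_comm (b := _ = i)] at this
    exact ⟨this.1, this.2.1⟩

theorem isAltWord_altWord {c : Fin (n + 1) → ℕ}
    (hc : ∀ i j, Adj i j → c j = c i + 1 ∨ c i = c j + 1) (k : ℕ) : IsAltWord (altWord c k) :=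
  fun _ _ hij => (filter_altWord_of_adj hc hij k).1

theorem altWord_commEquiv_reverse {c : Fin (n + 1) → ℕ}
    (hc : ∀ i j, Adj i j → c j = c i + 1 ∨ c i = c j + 1) (k : ℕ) :
    CommEquiv (affineC n) (altWord c k) (altWord c k).reverse := by
  refine CommEquiv.of_filter_eq fun a b hab => ?_
  by_cases hab' : a = b
  · subst hab'
    simp only [or_self, List.filter_eq, List.count_reverse]
  · have hadj : Adj a b := by
      by_contra h
      exact hab (affineC_eq_two_iff.mpr ⟨hab', h⟩)
    rw [List.filter_reverse, (filter_altWord_of_adj hc hadj k).2]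

theorem count_altWord_sum (c : Fin (n + 1) → ℕ) (i : Fin (n + 1)) :
    (altWord c (∑ j, c j)).count i = c i := by
  have := Finset.single_le_sum (f := c) (fun j _ => Nat.zero_le _) (Finset.mem_univ i)
  rw [count_altWord, if_pos (by omega)]

theorem length_altWord_sum (c : Fin (n + 1) → ℕ) :
    (altWord c (∑ j, c j)).length = ∑ j, c j := by
  simp only [length_eq_sum_count, count_altWord_sum]

theorem IsZig.isFCWord (hn : 2 ≤ n) {z : List (Fin (n + 1))} (hz : IsZig z) :
    IsFCWord (affineC n) z := by
  intro v hv
  obtain rfl := hz.eq_of_commEquiv hv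
  refine ⟨fun s hs => (hz.1 s s hs).ne rfl, fun s t hst hs => ?_⟩
  have hne : s ≠ t := by
    rintro rfl
    rw [(affineC n).diagonal] at hst
    omega
  have hadj : Adj s t := by
    by_contra h
    rw [affineC_eq_two_iff.mpr ⟨hne, h⟩] at hst
    omega
  rw [braidWord] at hs
  rcases affineC_of_adj hadj with h | h <;> rw [h.1] at hs
  · obtain ⟨x, y, rfl⟩ := hs
    have h1 := hz.2 s t ⟨x, t :: y, by simp [alternatingWord]⟩
    have h2 := hz.2 t s ⟨x ++ [s], y, by simp [alternatingWord]⟩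
    unfold IsEnd at h1 h2
    unfold Adj at hadj
    omega
  · exact h.2.1 (hz.2 t s (by simpa [alternatingWord] using hs))

/-- Zigzags that are long palindromes are not alternating words. -/
theorem IsZig.not_isAltWord (hn : 2 ≤ n) {z : List (Fin (n + 1))} (hz : IsZig z)
    (hr : z.reverse = z) (hlen : 2 ≤ z.length) : ¬ IsAltWord z := by
  intro ha
  have hp := (List.Palindrome.of_reverse_eq hr).exists_factor
  rcases Nat.even_or_odd z.length with he | ho
  · obtain ⟨a, h⟩ := hp.1 he (by
      rintro rfl
      simp at hlen)
    exact (hz.1 a a h).ne rfl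
  · obtain ⟨a, b, h⟩ := hp.2 ho (by omega)
    have hab : Adj a b := hz.1 a b ((List.prefix_append [a, b] [a]).isInfix.trans h)
    have h1 := hz.2 a b h
    have h2 := ha.isEnd hab h
    unfold IsEnd at h1 h2
    unfold Adj at hab
    omega

/-- The palindromic zigzags of a given length. -/
def palZigs (n L : ℕ) : Set (List (Fin (n + 1))) :=
  {z | IsZig z ∧ z.reverse = z ∧ z.length = L}

theorem finite_palZigs (n L : ℕ) : (palZigs n L).Finite :=
  (List.finite_length_eq (Fin (n + 1)) L).subset fun _ h => h.2.2

theorem exists_eq_of_mem_palZigs {L : ℕ} {z : List (Fin (n + 1))} (hz : z ∈ palZigs n (L + 2)) :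
    ∃ a w, z = a :: (w ++ [a]) ∧ w ∈ palZigs n L := by
  obtain ⟨h1, h2, h3⟩ := hz
  rcases List.Palindrome.of_reverse_eq h2 with _ | _ | ⟨a, hw⟩
  · simp at h3
  · simp at h3
  · rename_i w
    exact ⟨a, w, rfl, h1.of_factor ⟨[a], [a], by simp⟩, hw.reverse_eq, by simpa using h3⟩

theorem ncard_palZigs_add_two {L : ℕ} (hL : 2 ≤ L) :
    (palZigs n (L + 2)).ncard = (palZigs n L).ncard := by
  refine Set.ncard_congr (fun z _ => z.tail.dropLast) ?_ ?_ ?_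
  · intro z hz
    obtain ⟨a, w, rfl, hw⟩ := exists_eq_of_mem_palZigs hz
    simpa using hw
  · intro z z' hz hz' h
    obtain ⟨a, w, rfl, hw⟩ := exists_eq_of_mem_palZigs hz
    obtain ⟨b, w', rfl, -⟩ := exists_eq_of_mem_palZigs hz'
    obtain rfl : w = w' := by simpa using h
    rcases w with _ | ⟨x, _ | ⟨y, t⟩⟩
    · have := hw.2.2
      simp at this
      omega
    · have := hw.2.2
      simp at this
      omega
    have hax : Adj a x := IsZig.adj (x := []) (y := y :: t ++ [a]) (by simpa using hz.1)
    have hbx : Adj b x := IsZig.adj (x := []) (y := y :: t ++ [b]) (by simpa using hz'.1)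
    have hxy : Adj x y := IsZig.adj (x := []) (y := t) hw.1
    have hab : a = b := by
      by_contra hab
      rcases hax.symm.eq_or_eq hbx.symm hxy hab with rfl | rfl
      · exact hab (hax.symm.eq_of_isEnd hbx.symm
          (IsZig.isEnd (x := []) (y := t ++ [y]) (by simpa using hz.1)))
      · exact hab (hax.symm.eq_of_isEnd hbx.symm
          (IsZig.isEnd (x := []) (y := t ++ [y]) (by simpa using hz'.1)))
    rw [hab]
  · intro w hw
    rcases w with _ | ⟨x, _ | ⟨y, t⟩⟩
    · have := hw.2.2
      simp at this
      omega
    · have := hw.2.2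
      simp at this
      omega
    have hxy : Adj x y := IsZig.adj (x := []) (y := t) hw.1
    obtain ⟨a, hxa, hay⟩ : ∃ a, Adj x a ∧ (a = y → IsEnd x) := by
      by_cases hx : IsEnd x
      · exact ⟨y, hxy, fun _ => hx⟩
      · obtain ⟨a, hxa, hay⟩ := exists_adj_ne hxy hx
        exact ⟨a, hxa, fun h => (hay h).elim⟩
    have h1 : IsZig (a :: x :: y :: t) := hw.1.cons hxa.symm hay
    have h2 : x :: y :: t = t.reverse ++ [y, x] := by
      rw [← hw.2.1]
      simp
    refine ⟨a :: (x :: y :: t ++ [a]), ⟨?_, ?_, ?_⟩, List.dropLast_concat⟩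
    · rw [h2] at h1 ⊢
      have := IsZig.append_singleton (x := a :: t.reverse) (by simpa using h1) hxa
        fun h => hay h.symm
      simpa using this
    · have := hw.2.1
      simp only [List.reverse_cons, List.reverse_append, List.cons_append] at this ⊢
      simp [this]
    · have := hw.2.2
      simp only [List.length_cons, List.length_append] at this ⊢
      simp
      omega

theorem ncard_palZigs_add {L : ℕ} (hL : 2 ≤ L) (k : ℕ) :
    (palZigs n (L + 2 * k)).ncard = (palZigs n L).ncard := by
  induction k with
  | zero => rfl
  | succ k ih => exact (ncard_palZigs_add_two (by omega : 2 ≤ L + 2 * k)).trans ih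

theorem le_add_of_forall_adj {f : Fin (n + 1) → ℕ} {d : ℕ} (hf : ∀ i j, Adj i j → f i ≤ f j + d)
    (i j : Fin (n + 1)) : f i ≤ f j + d * (2 * n) := by
  have key : ∀ k (hk : k < n + 1), f ⟨k, hk⟩ ≤ f 0 + d * k ∧ f 0 ≤ f ⟨k, hk⟩ + d * k := by
    intro k
    induction k with
    | zero => exact fun _ => ⟨le_rfl, le_rfl⟩
    | succ k ih =>
      intro hk
      have h1 := ih (by omega)
      have h2 := hf ⟨k, by omega⟩ ⟨k + 1, hk⟩ (.inl rfl)
      have h3 := hf ⟨k + 1, hk⟩ ⟨k, by omega⟩ (.inr rfl)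
      rw [Nat.mul_succ]
      omega
  have h1 := (key i i.is_lt).1
  have h2 := (key j j.is_lt).2
  have h3 : d * i ≤ d * n := Nat.mul_le_mul_left d (by omega)
  have h4 : d * j ≤ d * n := Nat.mul_le_mul_left d (by omega)
  have h5 : d * (2 * n) = d * n + d * n := by ring
  simp only [Fin.eta] at h1 h2
  omega

theorem sum_le_of_forall_adj {f : Fin (n + 1) → ℕ} {d : ℕ} (hf : ∀ i j, Adj i j → f i ≤ f j + d)
    {j : Fin (n + 1)} {b : ℕ} (hj : f j ≤ b) : ∑ i, f i ≤ (n + 1) * (b + d * (2 * n)) := by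
  have := Finset.sum_le_card_nsmul Finset.univ f (b + d * (2 * n)) fun i _ =>
    (le_add_of_forall_adj hf i j).trans (Nat.add_le_add_right hj _)
  simpa using this

/-- The multiplicity functions of the letters of alternating self-dual words of length `L`. -/
def altCounts (n L : ℕ) : Set (Fin (n + 1) → ℕ) :=
  {c | (∀ i j, Adj i j → c j = c i + 1 ∨ c i = c j + 1) ∧ ∑ i, c i = L}

theorem finite_altCounts (n L : ℕ) : (altCounts n L).Finite := by
  refine (Set.Finite.pi' fun _ : Fin (n + 1) => Set.finite_Iic L).subset fun c hc i => ?_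
  rw [Set.mem_Iic, ← hc.2]
  exact Finset.single_le_sum (f := c) (fun j _ => Nat.zero_le _) (Finset.mem_univ i)

theorem le_add_one_of_mem_altCounts {L : ℕ} {c : Fin (n + 1) → ℕ} (hc : c ∈ altCounts n L)
    (i j : Fin (n + 1)) (hij : Adj i j) : c i ≤ c j + 1 := by
  have := hc.1 i j hij
  omega

theorem ncard_altCounts_add {L : ℕ} (hL : (n + 1) * (4 * n + 1) < L) :
    (altCounts n (L + (2 * n + 2))).ncard = (altCounts n L).ncard := by
  symm
  refine Set.ncard_congr (fun c _ i => c i + 2) ?_ ?_ ?_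
  · intro c hc
    refine ⟨fun i j hij => ?_, ?_⟩
    · have := hc.1 i j hij
      dsimp only
      omega
    · rw [Finset.sum_add_distrib, hc.2]
      simp
      ring
  · intro c c' _ _ h
    funext i
    simpa using congrFun h i
  · intro c hc
    have h2 : ∀ i, 2 ≤ c i := by
      intro i
      by_contra hi
      have h1 := sum_le_of_forall_adj (le_add_one_of_mem_altCounts hc) (j := i) (b := 1) (by omega)
      rw [hc.2] at h1
      have h3 : (n + 1) * (1 + 1 * (2 * n)) ≤ (n + 1) * (4 * n + 1) :=
        Nat.mul_le_mul_left _ (by omega)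
      omega
    refine ⟨fun i => c i - 2, ⟨fun i j hij => ?_, ?_⟩, ?_⟩
    · have := hc.1 i j hij
      have := h2 i
      have := h2 j
      dsimp only
      omega
    · have h3 : ∑ i, c i = ∑ i, (c i - 2) + ∑ _i : Fin (n + 1), 2 := by
        rw [← Finset.sum_add_distrib]
        exact Finset.sum_congr rfl fun i _ => (Nat.sub_add_cancel (h2 i)).symm
      rw [hc.2] at h3
      simp at h3
      dsimp only
      omega
    · funext i
      exact Nat.sub_add_cancel (h2 i)

theorem setOf_fcInvolution_eq (hn : 2 ≤ n) {L : ℕ} (hL : (n + 1) * (4 * n + 1) < L) :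
    {w : (affineC n).Group | IsFCInvolution (affineC n).toCoxeterSystem w ∧
      (affineC n).toCoxeterSystem.length w = L} =
    (fun c => (affineC n).toCoxeterSystem.wordProd (altWord c (∑ i, c i))) '' altCounts n L ∪
      (affineC n).toCoxeterSystem.wordProd '' palZigs n L := by
  ext w
  rw [Set.mem_ofPred_eq, isFCInvolution_and_length_eq_iff (affineC n).toCoxeterSystem
    (affineC_simple_mul_simple_pow_ne_one hn) affineC_ne_zero]
  constructor
  · rintro ⟨u, hu, hr, rfl, rfl⟩
    by_cases hz : IsZig u
    · exact .inr ⟨u, ⟨hz, (hz.eq_of_commEquiv hr).symm, rfl⟩, rfl⟩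
    rw [length_eq_sum_count] at hL
    have ha : IsAltWord u := by
      by_contra ha
      have h1 : ∃ e, u.count e ≤ 1 := by
        rcases hu.exists_isEnd_count_le_one hn hz ha with h | h
        exacts [⟨_, h⟩, ⟨_, h⟩]
      obtain ⟨e, he⟩ := h1
      have := sum_le_of_forall_adj (f := fun i => u.count i) (d := 2)
        (fun i j hij => hu.count_le_of_adj hn hij hz) he
      have h3 : (n + 1) * (1 + 2 * (2 * n)) = (n + 1) * (4 * n + 1) := by ring
      omega
    have hpos : ∀ i, u.count i ≠ 0 := by
      intro i hi
      have := sum_le_of_forall_adj (f := fun i => u.count i) (d := 1)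
        (fun i j hij => ha.count_le hij) (j := i) (b := 0) hi.le
      have h3 : (n + 1) * (0 + 1 * (2 * n)) ≤ (n + 1) * (4 * n + 1) :=
        Nat.mul_le_mul_left _ (by omega)
      omega
    have hc : (fun i => u.count i) ∈ altCounts n u.length := by
      refine ⟨fun i j hij => ?_, (length_eq_sum_count u).symm⟩
      have h1 := ha.count_le hij
      have h2 := ha.count_le hij.symm
      have h3 := ha.count_ne hr hij (hpos i)
      dsimp only
      omega
    refine .inl ⟨_, hc, ?_⟩
    refine (CommEquiv.wordProd_eq _ ?_).symm
    exact ha.commEquiv (isAltWord_altWord hc.1 _) hr fun i => (count_altWord_sum (fun i => u.count i) i).symm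
  · rintro (⟨c, hc, rfl⟩ | ⟨z, hz, rfl⟩)
    · exact ⟨_, (isAltWord_altWord hc.1 _).isFCWord hn, altWord_commEquiv_reverse hc.1 _,
        (length_altWord_sum c).trans hc.2, rfl⟩
    · exact ⟨z, hz.1.isFCWord hn, by rw [hz.2.1]; exact .refl _, hz.2.2, rfl⟩

theorem commEquiv_of_wordProd_eq (hn : 2 ≤ n) {u v : List (Fin (n + 1))}
    (hu : IsFCWord (affineC n) u) (hv : IsFCWord (affineC n) v)
    (h : (affineC n).toCoxeterSystem.wordProd u = (affineC n).toCoxeterSystem.wordProd v) :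
    CommEquiv (affineC n) u v :=
  IsFCWord.commEquiv _ (affineC_simple_mul_simple_pow_ne_one hn) affineC_ne_zero hu
    (IsFCWord.isReduced _ (affineC_simple_mul_simple_pow_ne_one hn) affineC_ne_zero hv) h

theorem card_fcInvolution_eq (hn : 2 ≤ n) {L : ℕ} (hL : (n + 1) * (4 * n + 1) < L) :
    Nat.card {w : (affineC n).Group // IsFCInvolution (affineC n).toCoxeterSystem w ∧
      (affineC n).toCoxeterSystem.length w = L} =
    (altCounts n L).ncard + (palZigs n L).ncard := by
  refine (Nat.card_coe_set_eq {w : (affineC n).Group |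
    IsFCInvolution (affineC n).toCoxeterSystem w ∧
      (affineC n).toCoxeterSystem.length w = L}).trans ?_
  have hL2 : 2 ≤ L := by
    have : 1 * 1 ≤ (n + 1) * (4 * n + 1) := Nat.mul_le_mul (by omega) (by omega)
    omega
  rw [setOf_fcInvolution_eq hn hL, Set.ncard_union_eq ?_ ((finite_altCounts n L).image _)
    ((finite_palZigs n L).image _), Set.InjOn.ncard_image, Set.InjOn.ncard_image]
  · intro z hz z' hz' h
    exact hz.1.eq_of_commEquiv (commEquiv_of_wordProd_eq hn (hz.1.isFCWord hn) (hz'.1.isFCWord hn) h)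
  · intro c hc c' hc' h
    have := commEquiv_of_wordProd_eq hn ((isAltWord_altWord hc.1 _).isFCWord hn)
      ((isAltWord_altWord hc'.1 _).isFCWord hn) h
    funext i
    rw [← count_altWord_sum c i, this.perm.count_eq, count_altWord_sum]
  · rw [Set.disjoint_left]
    rintro _ ⟨c, hc, rfl⟩ ⟨z, hz, h⟩
    have ha := isAltWord_altWord hc.1 (∑ i, c i)
    have := commEquiv_of_wordProd_eq hn (hz.1.isFCWord hn) (ha.isFCWord hn) h
    exact hz.1.not_isAltWord hn hz.2.1 (hz.2.2 ▸ hL2) (ha.of_commEquiv this.symm)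

end AffineC

/-- For `n ≥ 2`, the number `a(L)` of fully commutative involutions of Coxeter length
`L` in the affine Coxeter group of type `C̃_n` is ultimately periodic with period
dividing `2n + 2`: there exists `N` such that `a(L + 2n + 2) = a(L)` for all `L ≥ N`. -/
theorem ultimately_periodic_fcInvolutions_affineC (n : ℕ) (hn : 2 ≤ n) :
    ∃ N : ℕ, ∀ L : ℕ, N ≤ L →
      Nat.card {w : (affineC n).Group //
        IsFCInvolution (affineC n).toCoxeterSystem w ∧
        (affineC n).toCoxeterSystem.length w = L + (2 * n + 2)} =
      Nat.card {w : (affineC n).Group //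
        IsFCInvolution (affineC n).toCoxeterSystem w ∧
        (affineC n).toCoxeterSystem.length w = L} := by
  refine ⟨(n + 1) * (4 * n + 1) + 1, fun L hL => ?_⟩
  have h2 : 2 ≤ L := by
    have : 1 * 1 ≤ (n + 1) * (4 * n + 1) := Nat.mul_le_mul (by omega) (by omega)
    omega
  rw [card_fcInvolution_eq hn (by omega), card_fcInvolution_eq hn (by omega),
    ncard_altCounts_add (by omega), show L + (2 * n + 2) = L + 2 * (n + 1) by ring,
    ncard_palZigs_add h2]
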